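/- Suppose an X-ray estimate holds at dimension d ∈ (2,3) with exponents α, β ∈ (0,1) and constant A₀. Then there exist constants A, C > 0 (depending only on d, α, β, A₀) such that for every sufficiently small ε > 0 the following holds: if there exists a Besicovitch set E ⊆ ℝ³ with upper Minkowski dimension strictly less than d + ε, then for every sufficiently small δ > 0 (with ρ = δ^{1/2}) there exists a doubly sticky collection 𝕋 of δ-tubes with constants (A, C), with parent collection 𝕋_ρ of ρ-tubes and grandparent collection 𝕋_{δ^{1/4}} of δ^{1/4}-tubes, satisfying the volume bounds |⋃_{T∈𝕋} T| ≤ A δ^{−Cε} δ^{3−d}, |⋃_{T_ρ∈𝕋_ρ} T_ρ| ≤ A δ^{−Cε} ρ^{3−d}, and |⋃_{T'∈𝕋_{δ^{1/4}}} T'| ≤ A δ^{−Cε} δ^{(3−d)/4}. -/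

import Mathlib

open MeasureTheory Metric Set
open scoped ENNReal NNReal RealInnerProductSpace

noncomputable section

abbrev R3 : Type := EuclideanSpace ℝ (Fin 3)

/-- A tube core: a line segment joining the planes {z = 0} and {z = 1},
with orientation within 1/10 of the vertical. -/
structure Tube where
  p0 : R3
  p1 : R3
  h0 : p0 2 = 0
  h1 : p1 2 = 1
  hx : |(p1 - p0) 0| ≤ 1/10
  hy : |(p1 - p0) 1| ≤ 1/10

/-- The direction of a tube: the difference of its endpoints. -/
def Tube.dir (T : Tube) : R3 := T.p1 - T.p0

/-- The σ-tube associated to a tube core: the σ-neighbourhood of the segment. -/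
def Tube.set (T : Tube) (σ : ℝ) : Set R3 :=
  Metric.thickening σ (segment ℝ T.p0 T.p1)

/-- A direction: a vector (x, y, 1) within 1/10 of the vertical. -/
def IsDirection (v : R3) : Prop := v 2 = 1 ∧ |v 0| ≤ 1/10 ∧ |v 1| ≤ 1/10

/-- Two σ-tubes are equivalent (with constant C): each lies in the C-dilate of the other. -/
def TubeEquiv (C σ : ℝ) (T T' : Tube) : Prop :=
  T.set σ ⊆ T'.set (C * σ) ∧ T'.set σ ⊆ T.set (C * σ)

/-- A collection of σ-tubes is essentially distinct (with constant C): each of its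
tubes is equivalent to at most C of the others. -/
def EssDistinct (C σ : ℝ) (𝕋 : Set Tube) : Prop :=
  𝕋.Finite ∧ ∀ T ∈ 𝕋, (({T' ∈ 𝕋 | T' ≠ T ∧ TubeEquiv C σ T T'}.ncard : ℝ)) ≤ C

/-- A δ-separated set. -/
def Separated (δ : ℝ) (E : Set R3) : Prop :=
  ∀ x ∈ E, ∀ y ∈ E, x ≠ y → δ ≤ dist x y

/-- The directional multiplicity of 𝕋 at scale σ is at most m: at most m of the
tubes have directions in any cap of radius σ. -/
def DirMultLE (σ : ℝ) (𝕋 : Set Tube) (m : ℝ) : Prop :=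
  ∀ ω : R3, (({T ∈ 𝕋 | dist T.dir ω ≤ σ}.ncard : ℝ)) ≤ m

/-- The multiplicity function ∑_{T ∈ 𝕋} χ_T of a collection of σ-tubes. -/
def tubeCount (σ : ℝ) (𝕋 : Set Tube) (x : R3) : ℝ :=
  (({T ∈ 𝕋 | x ∈ T.set σ}).ncard : ℝ)

/-- The L^p norm ‖∑_{T ∈ 𝕋} χ_T‖_{L^p(ℝ³)}. -/
def tubeNorm (σ p : ℝ) (𝕋 : Set Tube) : ℝ≥0∞ :=
  (∫⁻ x : R3, ENNReal.ofReal (tubeCount σ 𝕋 x ^ p)) ^ (1 / p)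

/-- An X-ray estimate at dimension d with exponents α, β and constant A₀:
for every 0 < δ < 1, every δ-separated set of directions 𝓔 and every collection 𝕋 of
essentially distinct δ-tubes pointing in directions in 𝓔,
‖∑_{T∈𝕋} χ_T‖_{d'} ≤ A₀ δ^{1-3/d} m^{1-β} (δ² #𝓔)^α where m bounds the directional
multiplicity of 𝕋 and d' = d/(d-1). -/
def XRayEstimate (Ceq d α β A₀ : ℝ) : Prop :=
  ∀ δ : ℝ, 0 < δ → δ < 1 →
    ∀ 𝓔 : Set R3, (∀ v ∈ 𝓔, IsDirection v) → Separated δ 𝓔 → 𝓔.Finite →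
      ∀ 𝕋 : Set Tube, EssDistinct Ceq δ 𝕋 → (∀ T ∈ 𝕋, T.dir ∈ 𝓔) →
        ∀ m : ℝ, DirMultLE δ 𝕋 m →
          tubeNorm δ (d / (d - 1)) 𝕋 ≤
            ENNReal.ofReal (A₀ * δ ^ (1 - 3 / d) * m ^ (1 - β) * (δ ^ 2 * 𝓔.ncard) ^ α)

/-- A Kakeya estimate at dimension d with exponent α and constant A₀ (the β = 0
case of the X-ray estimate). -/
def KakeyaEstimate (Ceq d α A₀ : ℝ) : Prop :=
  ∀ δ : ℝ, 0 < δ → δ < 1 →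
    ∀ 𝓔 : Set R3, (∀ v ∈ 𝓔, IsDirection v) → Separated δ 𝓔 → 𝓔.Finite →
      ∀ 𝕋 : Set Tube, EssDistinct Ceq δ 𝕋 → (∀ T ∈ 𝕋, T.dir ∈ 𝓔) →
        ∀ m : ℝ, DirMultLE δ 𝕋 m →
          tubeNorm δ (d / (d - 1)) 𝕋 ≤
            ENNReal.ofReal (A₀ * δ ^ (1 - 3 / d) * m * (δ ^ 2 * 𝓔.ncard) ^ α)

/-- A Besicovitch (Kakeya) set: a set containing a unit line segment in every direction. -/
def IsBesicovitch (E : Set R3) : Prop :=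
  ∀ e : R3, ‖e‖ = 1 → ∃ x : R3, segment ℝ x (x + e) ⊆ E

/-- The δ-entropy of a set: the maximal cardinality of a δ-separated subset. -/
def entropy (δ : ℝ) (E : Set R3) : ℝ≥0∞ :=
  ⨆ (S : Set R3) (_ : S ⊆ E) (_ : Separated δ S), S.encard

/-- Extended logarithm on ℝ≥0∞ (equal to log on finite values, ⊤ at ⊤). -/
def elog (x : ℝ≥0∞) : EReal :=
  if x = ⊤ then (⊤ : EReal) else ((Real.log x.toReal : ℝ) : EReal)

/-- The upper Minkowski dimension: limsup_{δ → 0⁺} log 𝓔_δ(E) / log (1/δ). -/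
def upperMinkDim (E : Set R3) : EReal :=
  Filter.limsup
    (fun δ : ℝ => elog (entropy δ E) * (((Real.log (1 / δ))⁻¹ : ℝ) : EReal))
    (nhdsWithin 0 (Set.Ioi 0))

/-- A collection 𝕋 of σ-tubes is sticky with constants (A, C) (relative to ε):
it is direction-separated at scale σ (directional multiplicity ≤ A σ^{-Cε}),
has cardinality ≈ σ^{-2}, and there is a direction-separated collection 𝕋p of
σ^{1/2}-tubes of cardinality ≈ σ^{-1} (the parent tubes), together with an
assignment par : 𝕋 → 𝕋p such that each T ∈ 𝕋 is contained in its parent tube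
and each parent has ≈ σ^{-1} children. -/
def StickyWith (A C ε σ : ℝ) (𝕋 𝕋p : Set Tube) (par : Tube → Tube) : Prop :=
  𝕋.Finite ∧ 𝕋p.Finite ∧
  DirMultLE σ 𝕋 (A * σ ^ (-(C * ε))) ∧
  DirMultLE (σ ^ (1/2 : ℝ)) 𝕋p (A * σ ^ (-(C * ε))) ∧
  A⁻¹ * σ ^ (C * ε) * σ ^ (-2 : ℝ) ≤ (𝕋.ncard : ℝ) ∧
  (𝕋.ncard : ℝ) ≤ A * σ ^ (-(C * ε)) * σ ^ (-2 : ℝ) ∧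
  A⁻¹ * σ ^ (C * ε) * σ ^ (-1 : ℝ) ≤ (𝕋p.ncard : ℝ) ∧
  (𝕋p.ncard : ℝ) ≤ A * σ ^ (-(C * ε)) * σ ^ (-1 : ℝ) ∧
  (∀ T ∈ 𝕋, par T ∈ 𝕋p ∧ T.set σ ⊆ (par T).set (σ ^ (1/2 : ℝ))) ∧
  (∀ Tp ∈ 𝕋p,
    A⁻¹ * σ ^ (C * ε) * σ ^ (-1 : ℝ) ≤ ({T ∈ 𝕋 | par T = Tp}.ncard : ℝ) ∧
    ({T ∈ 𝕋 | par T = Tp}.ncard : ℝ) ≤ A * σ ^ (-(C * ε)) * σ ^ (-1 : ℝ))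

/-- The vector of ℝ³ with the given coordinates. -/
def vec (a b c : ℝ) : R3 := WithLp.toLp 2 ![a, b, c]

@[simp] lemma vec_zero (a b c : ℝ) : vec a b c 0 = a := rfl
@[simp] lemma vec_one (a b c : ℝ) : vec a b c 1 = b := rfl
@[simp] lemma vec_two (a b c : ℝ) : vec a b c 2 = c := rfl

lemma abs_coord_sub_le_dist (x y : R3) (i : Fin 3) : |x i - y i| ≤ dist x y := by
  have := PiLp.norm_apply_le (x - y) i
  rwa [Real.norm_eq_abs, PiLp.sub_apply, ← dist_eq_norm] at this

lemma dist_le_of_coords {x y : R3} {s : ℝ} (h0 : |x 0 - y 0| ≤ s) (h1 : |x 1 - y 1| ≤ s)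
    (h2 : x 2 = y 2) : dist x y ≤ 2 * s := by
  have hs : 0 ≤ s := (abs_nonneg _).trans h0
  rw [EuclideanSpace.dist_eq, Fin.sum_univ_three, Real.dist_eq, Real.dist_eq, Real.dist_eq, h2]
  apply Real.sqrt_le_iff.2
  refine ⟨by positivity, ?_⟩
  have e0 := pow_le_pow_left₀ (abs_nonneg _) h0 2
  have e1 := pow_le_pow_left₀ (abs_nonneg _) h1 2
  simp only [sub_self, abs_zero]
  nlinarith

lemma Tube.dir_two (T : Tube) : T.dir 2 = 1 := by
  simp [Tube.dir, T.h0, T.h1]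

lemma Tube.ext_coords {T T' : Tube} (h0 : T.p0 0 = T'.p0 0) (h1 : T.p0 1 = T'.p0 1)
    (h2 : T.dir 0 = T'.dir 0) (h3 : T.dir 1 = T'.dir 1) : T = T' := by
  have e0 : T.p0 = T'.p0 := by
    ext i; fin_cases i
    · exact h0
    · exact h1
    · exact T.h0.trans T'.h0.symm
  have e1 : T.p1 = T'.p1 := by
    simp only [Tube.dir, PiLp.sub_apply, h0, h1] at h2 h3
    ext i; fin_cases i
    · simpa using h2
    · simpa using h3
    · exact T.h1.trans T'.h1.symm
  cases T; cases T'; simp_all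

lemma Tube.exists_of_mem_segment {T : Tube} {x : R3} (hx : x ∈ segment ℝ T.p0 T.p1) :
    ∃ t : ℝ, 0 ≤ t ∧ t ≤ 1 ∧ x = T.p0 + t • T.dir := by
  rw [segment_eq_image'] at hx
  obtain ⟨t, ht, rfl⟩ := hx
  exact ⟨t, ht.1, ht.2, rfl⟩

lemma Tube.mem_segment (T : Tube) {t : ℝ} (h0 : 0 ≤ t) (h1 : t ≤ 1) :
    T.p0 + t • T.dir ∈ segment ℝ T.p0 T.p1 := by
  rw [segment_eq_image']
  exact ⟨t, ⟨h0, h1⟩, rfl⟩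

/-- Rounding towards zero to a multiple of `s`. -/
def truncIdx (s x : ℝ) : ℤ := if 0 ≤ x then ⌊x / s⌋ else ⌈x / s⌉

lemma abs_trunc_le {s : ℝ} (hs : 0 < s) (x : ℝ) : |s * truncIdx s x| ≤ |x| := by
  unfold truncIdx
  split_ifs with h
  · have h1 : (0 : ℝ) ≤ ⌊x / s⌋ := by exact_mod_cast Int.floor_nonneg.2 (by positivity)
    have h2 := (le_div_iff₀ hs).1 (Int.floor_le (x / s))
    rw [abs_of_nonneg (by positivity), abs_of_nonneg h]; linarith
  · push Not at h
    have h1 : (⌈x / s⌉ : ℝ) ≤ 0 := by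
      exact_mod_cast Int.ceil_le.2 (by simpa using (div_neg_of_neg_of_pos h hs).le)
    have h2 := (div_le_iff₀ hs).1 (Int.le_ceil (x / s))
    rw [abs_of_nonpos (mul_nonpos_of_nonneg_of_nonpos hs.le h1), abs_of_neg h]; linarith

lemma abs_sub_trunc_le {s : ℝ} (hs : 0 < s) (x : ℝ) : |x - s * truncIdx s x| ≤ s := by
  unfold truncIdx
  split_ifs with h
  · have h1 := (div_lt_iff₀ hs).1 (Int.lt_floor_add_one (x / s))
    have h2 := (le_div_iff₀ hs).1 (Int.floor_le (x / s))
    rw [abs_le]; constructor <;> linarith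
  · have h1 := (lt_div_iff₀ hs).1 (sub_lt_iff_lt_add.2 (Int.ceil_lt_add_one (x / s)))
    have h2 := (div_le_iff₀ hs).1 (Int.le_ceil (x / s))
    rw [abs_le]; constructor <;> linarith

/-- The tube with position and direction rounded to multiples of `s`. -/
def roundTube (s : ℝ) (hs : 0 < s) (T : Tube) : Tube where
  p0 := vec (s * truncIdx s (T.p0 0)) (s * truncIdx s (T.p0 1)) 0
  p1 := vec (s * truncIdx s (T.p0 0) + s * truncIdx s (T.dir 0))
    (s * truncIdx s (T.p0 1) + s * truncIdx s (T.dir 1)) 1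
  h0 := rfl
  h1 := rfl
  hx := by simpa using (abs_trunc_le hs (T.dir 0)).trans T.hx
  hy := by simpa using (abs_trunc_le hs (T.dir 1)).trans T.hy

/-- The parent tube of `T` at scale `τ`: its position and direction are those of `T`, rounded
to multiples of `τ / 8`. -/
def parent (τ : ℝ) (T : Tube) : Tube :=
  if h : 0 < τ / 8 then roundTube (τ / 8) h T else T

/-- The tubes whose position and direction have coordinates in `s ℤ`. -/
def OnGrid (s : ℝ) (T : Tube) : Prop :=
  (∃ i : ℤ, T.p0 0 = s * i) ∧ (∃ i : ℤ, T.p0 1 = s * i) ∧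
  (∃ i : ℤ, T.dir 0 = s * i) ∧ (∃ i : ℤ, T.dir 1 = s * i)

lemma parent_eq {τ : ℝ} (hτ : 0 < τ) (T : Tube) :
    parent τ T = roundTube (τ / 8) (by positivity) T := dif_pos (by positivity)

lemma onGrid_parent {τ : ℝ} (hτ : 0 < τ) (T : Tube) : OnGrid (τ / 8) (parent τ T) := by
  rw [parent_eq hτ]
  refine ⟨⟨_, rfl⟩, ⟨_, rfl⟩, ⟨truncIdx (τ / 8) (T.dir 0), ?_⟩,
    ⟨truncIdx (τ / 8) (T.dir 1), ?_⟩⟩ <;>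
  simp [roundTube, Tube.dir]

lemma dist_parent_p0 {τ : ℝ} (hτ : 0 < τ) (T : Tube) : dist T.p0 (parent τ T).p0 ≤ τ / 4 := by
  have hs : 0 < τ / 8 := by positivity
  rw [parent_eq hτ]
  have := dist_le_of_coords (x := T.p0) (y := (roundTube (τ / 8) hs T).p0)
    (abs_sub_trunc_le hs _) (abs_sub_trunc_le hs _) T.h0
  linarith

lemma dist_parent_dir {τ : ℝ} (hτ : 0 < τ) (T : Tube) : dist T.dir (parent τ T).dir ≤ τ / 4 := by
  have hs : 0 < τ / 8 := by positivity
  rw [parent_eq hτ]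
  have := dist_le_of_coords (x := T.dir) (y := (roundTube (τ / 8) hs T).dir) (s := τ / 8)
    (by simpa [roundTube, Tube.dir] using abs_sub_trunc_le hs (T.dir 0))
    (by simpa [roundTube, Tube.dir] using abs_sub_trunc_le hs (T.dir 1))
    (by rw [Tube.dir_two, Tube.dir_two])
  linarith

lemma exists_near_of_parent {τ : ℝ} (hτ : 0 < τ) (T : Tube) {x : R3}
    (hx : x ∈ segment ℝ (parent τ T).p0 (parent τ T).p1) :
    ∃ y ∈ segment ℝ T.p0 T.p1, dist x y ≤ τ / 2 := by
  obtain ⟨t, h0, h1, rfl⟩ := Tube.exists_of_mem_segment hx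
  refine ⟨_, T.mem_segment h0 h1, ?_⟩
  refine (dist_add_add_le _ _ _ _).trans ?_
  have e1 := dist_parent_p0 hτ T
  have e2 := dist_parent_dir hτ T
  rw [dist_smul₀, Real.norm_of_nonneg h0, dist_comm, dist_comm (parent τ T).dir]
  nlinarith

lemma exists_parent_near {τ : ℝ} (hτ : 0 < τ) (T : Tube) {x : R3}
    (hx : x ∈ segment ℝ T.p0 T.p1) :
    ∃ y ∈ segment ℝ (parent τ T).p0 (parent τ T).p1, dist x y ≤ τ / 2 := by
  obtain ⟨t, h0, h1, rfl⟩ := Tube.exists_of_mem_segment hx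
  refine ⟨_, (parent τ T).mem_segment h0 h1, ?_⟩
  refine (dist_add_add_le _ _ _ _).trans ?_
  have e1 := dist_parent_p0 hτ T
  have e2 := dist_parent_dir hτ T
  rw [dist_smul₀, Real.norm_of_nonneg h0]
  nlinarith

lemma set_subset_parent {τ : ℝ} (hτ : 0 < τ) (T : Tube) {σ : ℝ} (hσ : σ ≤ τ / 2) :
    T.set σ ⊆ (parent τ T).set τ := by
  intro x hx
  obtain ⟨y, hy, hxy⟩ := mem_thickening_iff.1 hx
  obtain ⟨z, hz, hyz⟩ := exists_parent_near hτ T hy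
  exact mem_thickening_iff.2 ⟨z, hz, by linarith [dist_triangle x y z]⟩

lemma eq_or_le_of_residue_eq {s : ℝ} (hs : 0 < s) {K : ℕ} {x y : ℝ}
    (hx : ∃ i : ℤ, x = s * i) (hy : ∃ i : ℤ, y = s * i)
    (h : ((⌊x / s⌋ : ℤ) : ZMod K) = ((⌊y / s⌋ : ℤ) : ZMod K)) : x = y ∨ K * s ≤ |x - y| := by
  obtain ⟨i, rfl⟩ := hx
  obtain ⟨j, rfl⟩ := hy
  rw [mul_div_cancel_left₀ _ hs.ne', mul_div_cancel_left₀ _ hs.ne', Int.floor_intCast,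
    Int.floor_intCast, ZMod.intCast_eq_intCast_iff_dvd_sub] at h
  by_cases hij : i = j
  · left; rw [hij]
  · right
    have h1 : (K : ℤ) ≤ |j - i| :=
      Int.le_of_dvd (abs_pos.2 (sub_ne_zero.2 (Ne.symm hij))) ((dvd_abs _ _).2 h)
    have h2 : (K : ℝ) ≤ |(i : ℝ) - j| := by rw [abs_sub_comm]; exact_mod_cast h1
    rw [← mul_sub, abs_mul, abs_of_pos hs, mul_comm]
    gcongr

/-- The residues modulo `K` of the grid coordinates of a tube. -/
def tubeColor (s : ℝ) (K : ℕ) (T : Tube) : ZMod K × ZMod K × ZMod K × ZMod K :=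
  ((⌊T.p0 0 / s⌋ : ℤ), (⌊T.p0 1 / s⌋ : ℤ), (⌊T.dir 0 / s⌋ : ℤ), (⌊T.dir 1 / s⌋ : ℤ))

lemma Tube.near_of_equiv {C τ : ℝ} (hτ : 0 < τ) {T T' : Tube}
    (h : T.set τ ⊆ T'.set (C * τ)) (i : Fin 3) (hi : i ≠ 2) :
    |T.p0 i - T'.p0 i| < 2 * (C * τ) ∧ |T.dir i - T'.dir i| < 4 * (C * τ) := by
  have hd : |T'.dir i| ≤ 1 / 10 := by
    fin_cases i
    · exact T'.hx
    · exact T'.hy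
    · exact absurd rfl hi
  have key : ∀ x ∈ segment ℝ T.p0 T.p1, ∃ t : ℝ, 0 ≤ t ∧ t ≤ 1 ∧
      |x 2 - t| < C * τ ∧ |x i - (T'.p0 i + t * T'.dir i)| < C * τ := by
    intro x hx
    obtain ⟨y, hy, hxy⟩ := mem_thickening_iff.1 (h (self_subset_thickening hτ _ hx))
    obtain ⟨t, h0, h1, rfl⟩ := Tube.exists_of_mem_segment hy
    refine ⟨t, h0, h1, ?_, ?_⟩
    · have := (abs_coord_sub_le_dist x _ 2).trans_lt hxy
      simpa [T'.h0, T'.dir_two] using this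
    · have := (abs_coord_sub_le_dist x _ i).trans_lt hxy
      simpa using this
  obtain ⟨t, t0, t1, ht, hti⟩ := key _ (left_mem_segment ℝ _ _)
  obtain ⟨u, u0, u1, hu, hui⟩ := key _ (right_mem_segment ℝ _ _)
  rw [T.h0] at ht
  rw [T.h1] at hu
  have e1 : |t * T'.dir i| ≤ t := by
    rw [abs_mul, abs_of_nonneg t0]; nlinarith
  have e2 : |(1 - u) * T'.dir i| ≤ 1 - u := by
    rw [abs_mul, abs_of_nonneg (by linarith)]; nlinarith
  rw [abs_lt] at ht hti hu hui
  rw [abs_le] at e1 e2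
  have ed : T.dir i = T.p1 i - T.p0 i := rfl
  have hp : |T.p0 i - T'.p0 i| < 2 * (C * τ) := by rw [abs_lt]; constructor <;> linarith
  refine ⟨hp, ?_⟩
  rw [abs_lt] at hp ⊢
  constructor <;> rw [ed] <;> linarith

lemma Tube.eq_of_equiv {C τ : ℝ} (hτ : 0 < τ) (hC : 1 ≤ C) {K : ℕ} (hK : 32 * C ≤ K)
    {T T' : Tube} (hT : OnGrid (τ / 8) T) (hT' : OnGrid (τ / 8) T')
    (hc : tubeColor (τ / 8) K T = tubeColor (τ / 8) K T') (h : TubeEquiv C τ T T') : T = T' := by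
  have hs : 0 < τ / 8 := by positivity
  simp only [tubeColor, Prod.mk.injEq] at hc
  have hKs : 4 * (C * τ) ≤ K * (τ / 8) := by nlinarith
  have hCτ : 0 < C * τ := by positivity
  have n0 := Tube.near_of_equiv hτ h.1 0 (by decide)
  have n1 := Tube.near_of_equiv hτ h.1 1 (by decide)
  refine Tube.ext_coords ?_ ?_ ?_ ?_
  · exact (eq_or_le_of_residue_eq hs hT.1 hT'.1 hc.1).resolve_right (by linarith [n0.1])
  · exact (eq_or_le_of_residue_eq hs hT.2.1 hT'.2.1 hc.2.1).resolve_right (by linarith [n1.1])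
  · exact (eq_or_le_of_residue_eq hs hT.2.2.1 hT'.2.2.1 hc.2.2.1).resolve_right
      (by linarith [n0.2])
  · exact (eq_or_le_of_residue_eq hs hT.2.2.2 hT'.2.2.2 hc.2.2.2).resolve_right
      (by linarith [n1.2])

lemma Tube.separated_dir {τ : ℝ} (hτ : 0 < τ) {K : ℕ} (hK : 32 ≤ K)
    {T T' : Tube} (hT : OnGrid (τ / 8) T) (hT' : OnGrid (τ / 8) T')
    (hc : tubeColor (τ / 8) K T = tubeColor (τ / 8) K T') (h : T.dir ≠ T'.dir) :
    τ ≤ dist T.dir T'.dir := by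
  have hs : 0 < τ / 8 := by positivity
  simp only [tubeColor, Prod.mk.injEq] at hc
  have hK' : (32 : ℝ) ≤ K := by exact_mod_cast hK
  have hKs : τ ≤ K * (τ / 8) := by nlinarith
  by_contra! hlt
  refine h ?_
  ext i; fin_cases i
  · exact (eq_or_le_of_residue_eq hs hT.2.2.1 hT'.2.2.1 hc.2.2.1).resolve_right
      (by linarith [abs_coord_sub_le_dist T.dir T'.dir 0])
  · exact (eq_or_le_of_residue_eq hs hT.2.2.2 hT'.2.2.2 hc.2.2.2).resolve_right
      (by linarith [abs_coord_sub_le_dist T.dir T'.dir 1])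
  · exact T.dir_two.trans T'.dir_two.symm

lemma card_filter_dist_le {ι : Type*} (F : Finset ι) (v : ι → R3) (hv : ∀ i ∈ F, v i 2 = 1)
    {σ r M : ℝ} (hσ : 0 < σ) (hr : σ ≤ r) (hM0 : 0 ≤ M)
    (hM : ∀ ω : R3, ((F.filter fun i => dist (v i) ω ≤ σ).card : ℝ) ≤ M) (ω : R3) :
    ((F.filter fun i => dist (v i) ω ≤ r).card : ℝ) ≤ 36 * (r / σ) ^ 2 * M := by
  classical
  set s : ℝ := σ / 2 with hs
  have hs0 : 0 < s := by positivity
  have hr0 : 0 < r := hσ.trans_le hr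
  let I : ℝ → Finset ℤ := fun a => Finset.Icc ⌊(a - r) / s⌋ ⌊(a + r) / s⌋
  have hI : ∀ a, ((I a).card : ℝ) ≤ 6 * (r / σ) := by
    intro a
    have hle : ⌊(a - r) / s⌋ ≤ ⌊(a + r) / s⌋ + 1 := by
      have : (a - r) / s ≤ (a + r) / s := by
        apply div_le_div_of_nonneg_right _ hs0.le; linarith
      have := Int.floor_le_floor this
      lia
    have e : ((I a).card : ℤ) = ⌊(a + r) / s⌋ + 1 - ⌊(a - r) / s⌋ := Int.card_Icc_of_le _ _ hle
    have e' : ((I a).card : ℝ) = ⌊(a + r) / s⌋ + 1 - ⌊(a - r) / s⌋ := by exact_mod_cast e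
    have f1 := Int.floor_le ((a + r) / s)
    have f2 := Int.lt_floor_add_one ((a - r) / s)
    have f3 : (a + r) / s - (a - r) / s = 4 * (r / σ) := by rw [hs]; field_simp; ring
    have f4 : 1 ≤ r / σ := (one_le_div hσ).2 hr
    linarith
  have hmem : ∀ x a : ℝ, |x - a| ≤ r → ⌊x / s⌋ ∈ I a := by
    intro x a h
    rw [abs_le] at h
    refine Finset.mem_Icc.2 ⟨Int.floor_le_floor ?_, Int.floor_le_floor ?_⟩ <;> gcongr <;> linarith
  let c : ι → ℤ × ℤ := fun i => (⌊v i 0 / s⌋, ⌊v i 1 / s⌋)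
  have hmaps : ∀ i ∈ F.filter (fun i => dist (v i) ω ≤ r), c i ∈ I (ω 0) ×ˢ I (ω 1) := by
    intro i hi
    have h := (Finset.mem_filter.1 hi).2
    exact Finset.mem_product.2 ⟨hmem _ _ ((abs_coord_sub_le_dist _ _ 0).trans h),
      hmem _ _ ((abs_coord_sub_le_dist _ _ 1).trans h)⟩
  rw [Finset.card_eq_sum_card_fiberwise hmaps, Nat.cast_sum]
  have hfib : ∀ b ∈ I (ω 0) ×ˢ I (ω 1),
      (((F.filter fun i => dist (v i) ω ≤ r).filter fun i => c i = b).card : ℝ) ≤ M := by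
    intro b _
    refine le_trans ?_ (hM (vec (s * b.1) (s * b.2) 1))
    norm_cast
    refine Finset.card_le_card fun i hi => ?_
    rw [Finset.mem_filter, Finset.mem_filter] at hi
    refine Finset.mem_filter.2 ⟨hi.1.1, ?_⟩
    have hfl : ∀ x : ℝ, |x - s * ⌊x / s⌋| ≤ s := by
      intro x
      have h1 := (div_lt_iff₀ hs0).1 (Int.lt_floor_add_one (x / s))
      have h2 := (le_div_iff₀ hs0).1 (Int.floor_le (x / s))
      rw [abs_le]; constructor <;> linarith
    have := dist_le_of_coords (x := v i) (y := vec (s * b.1) (s * b.2) 1) (s := s)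
      (by rw [← hi.2]; exact hfl _) (by rw [← hi.2]; exact hfl _) (by rw [hv i hi.1.1, vec_two])
    rw [hs] at this ⊢
    linarith
  refine (Finset.sum_le_card_nsmul _ _ _ hfib).trans ?_
  rw [nsmul_eq_mul, Finset.card_product, Nat.cast_mul]
  have h0 := hI (ω 0)
  have h1 := hI (ω 1)
  have : ((I (ω 0)).card : ℝ) * (I (ω 1)).card ≤ (6 * (r / σ)) * (6 * (r / σ)) := by
    have : 0 ≤ 6 * (r / σ) := by positivity
    gcongr
  nlinarith

lemma norm_sub_vertical_le {v : R3} (hv : IsDirection v) : dist v (vec 0 0 1) ≤ 1 := by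
  have := dist_le_of_coords (x := v) (y := vec 0 0 1) (s := 1 / 10) (by simpa using hv.2.1)
    (by simpa using hv.2.2) (by rw [hv.1, vec_two])
  linarith

lemma Tube.isDirection_dir (T : Tube) : IsDirection T.dir := ⟨T.dir_two, T.hx, T.hy⟩

lemma card_le_of_cap {ι : Type*} (F : Finset ι) (v : ι → R3) (hv : ∀ i ∈ F, IsDirection (v i))
    {σ M : ℝ} (hσ : 0 < σ) (hσ1 : σ ≤ 1) (hM0 : 0 ≤ M)
    (hM : ∀ ω : R3, ((F.filter fun i => dist (v i) ω ≤ σ).card : ℝ) ≤ M) :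
    (F.card : ℝ) ≤ 36 * (1 / σ) ^ 2 * M := by
  classical
  have := card_filter_dist_le F v (fun i hi => (hv i hi).1) hσ hσ1 hM0 hM (vec 0 0 1)
  rwa [Finset.filter_true_of_mem fun i hi => norm_sub_vertical_le (hv i hi)] at this

lemma card_filter_le_one_of_separated {ι : Type*} (F : Finset ι) (v : ι → R3) {σ : ℝ} (hσ : 0 < σ)
    (h : ∀ i ∈ F, ∀ j ∈ F, i ≠ j → σ ≤ dist (v i) (v j)) (ω : R3) :
    ((F.filter fun i => dist (v i) ω ≤ σ / 3).card : ℝ) ≤ 1 := by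
  classical
  norm_cast
  refine Finset.card_le_one.2 fun i hi j hj => ?_
  rw [Finset.mem_filter] at hi hj
  by_contra hij
  have h1 := h i hi.1 j hj.1 hij
  have h2 := dist_triangle_right (v i) (v j) ω
  linarith [hi.2, hj.2]

lemma le_volume_tube (T : Tube) {τ : ℝ} (hτ : 0 < τ) :
    ENNReal.ofReal (τ ^ 2) ≤ volume (T.set τ) := by
  set n : ℕ := ⌊1 / (2 * τ)⌋₊ with hn
  have hn1 : (n : ℝ) * (2 * τ) ≤ 1 := by
    have := Nat.floor_le (a := 1 / (2 * τ)) (by positivity)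
    rwa [le_div_iff₀ (by positivity)] at this
  have hn2 : 1 / (2 * τ) ≤ ((n + 1 : ℕ) : ℝ) := by
    push_cast; exact (Nat.lt_floor_add_one _).le
  let p : ℕ → R3 := fun i => T.p0 + ((i : ℝ) * (2 * τ)) • T.dir
  have hsub : (⋃ i ∈ Finset.range (n + 1), ball (p i) τ) ⊆ T.set τ := by
    refine iUnion₂_subset fun i hi x hx => ?_
    have hi' : (i : ℝ) ≤ n := by exact_mod_cast Nat.lt_succ_iff.1 (Finset.mem_range.1 hi)
    exact mem_thickening_iff.2 ⟨p i, T.mem_segment (by positivity) (by nlinarith), hx⟩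
  have hdisj : (↑(Finset.range (n + 1)) : Set ℕ).PairwiseDisjoint fun i => ball (p i) τ := by
    intro i _ j _ hij
    refine ball_disjoint_ball ?_
    have h1 := abs_coord_sub_le_dist (p i) (p j) 2
    have h2 : p i 2 - p j 2 = ((i : ℝ) - j) * (2 * τ) := by
      simp [p, T.dir_two]; ring
    have h3 : (1 : ℝ) ≤ |(i : ℝ) - j| := by
      have : (1 : ℤ) ≤ |(i : ℤ) - j| := Int.one_le_abs (sub_ne_zero.2 (by exact_mod_cast hij))
      exact_mod_cast this
    rw [h2, abs_mul, abs_of_pos (by positivity : 0 < 2 * τ)] at h1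
    nlinarith
  refine le_trans ?_ (measure_mono hsub)
  rw [measure_biUnion_finset hdisj (fun _ _ => measurableSet_ball)]
  simp only [EuclideanSpace.volume_ball_fin_three, Finset.sum_const, Finset.card_range]
  rw [← ENNReal.ofReal_pow hτ.le, ← ENNReal.ofReal_mul (by positivity), nsmul_eq_mul,
    ← ENNReal.ofReal_natCast, ← ENNReal.ofReal_mul (by positivity)]
  apply ENNReal.ofReal_le_ofReal
  have h3 : τ ^ 2 = 1 / (2 * τ) * (τ ^ 3 * 2) := by field_simp
  have h4 := Real.pi_gt_three
  rw [h3]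
  gcongr
  linarith

lemma card_mul_le_tubeNorm (G : Finset Tube) {τ d : ℝ} (hτ : 0 < τ) (hd : 1 < d) :
    ENNReal.ofReal (G.card * τ ^ 2) ≤
      tubeNorm τ (d / (d - 1)) G * volume (⋃ T ∈ G, T.set τ) ^ (1 / d) := by
  classical
  set p := d / (d - 1) with hp
  have hpq : p.HolderConjugate d := (Real.HolderConjugate.conjExponent hd).symm
  set U : Set R3 := ⋃ T ∈ G, T.set τ
  have hopen : ∀ T : Tube, MeasurableSet (T.set τ) := fun T => isOpen_thickening.measurableSet
  have hU : MeasurableSet U := Finset.measurableSet_biUnion _ fun T _ => hopen T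
  set f : R3 → ℝ≥0∞ := fun x => ∑ T ∈ G, (T.set τ).indicator 1 x with hf
  have hfm : Measurable f := Finset.measurable_sum _ fun T _ => measurable_one.indicator (hopen T)
  have hcount : ∀ x, ENNReal.ofReal (tubeCount τ G x) = f x := by
    intro x
    have : {T ∈ (G : Set Tube) | x ∈ T.set τ} = ↑(G.filter fun T => x ∈ T.set τ) := by
      ext; simp
    rw [tubeCount, this, Set.ncard_coe_finset, ENNReal.ofReal_natCast, hf]
    simp only [Set.indicator_apply, Pi.one_apply, Finset.sum_boole]
  have hfp : ∀ x, ENNReal.ofReal (tubeCount τ G x ^ p) = f x ^ p := by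
    intro x
    rw [← hcount, ENNReal.ofReal_rpow_of_nonneg (by unfold tubeCount; positivity) hpq.nonneg]
  have hlow : ENNReal.ofReal (G.card * τ ^ 2) ≤ ∫⁻ x, f x := by
    rw [lintegral_finsetSum _ fun T _ => measurable_one.indicator (hopen T)]
    simp only [lintegral_indicator_one (hopen _)]
    rw [ENNReal.ofReal_mul (by positivity), ENNReal.ofReal_natCast, ← nsmul_eq_mul]
    exact Finset.card_nsmul_le_sum _ _ _ fun T _ => le_volume_tube T hτ
  have hmul : ∀ x, f x = (f * (U.indicator 1 : R3 → ℝ≥0∞)) x := by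
    intro x
    by_cases hx : x ∈ U
    · simp [hx]
    · have : f x = 0 := Finset.sum_eq_zero fun T hT =>
        Set.indicator_of_notMem (fun h => hx (mem_biUnion hT h)) _
      simp [this]
  refine hlow.trans ?_
  rw [lintegral_congr hmul]
  refine (ENNReal.lintegral_mul_le_Lp_mul_Lq volume hpq hfm.aemeasurable
    (measurable_one.indicator hU).aemeasurable).trans ?_
  rw [tubeNorm, lintegral_congr hfp]
  have hind : ∀ x, (U.indicator (1 : R3 → ℝ≥0∞) x) ^ d = U.indicator 1 x := by
    intro x
    by_cases hx : x ∈ U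
    · simp [hx]
    · simp [hx, hpq.symm.pos]
  rw [lintegral_congr hind, lintegral_indicator_one hU]

lemma exists_uniform_fibers {ι κ γ : Type*} [DecidableEq κ] [DecidableEq γ] [Fintype γ]
    (F : Finset ι) (p : ι → κ) (col : κ → γ) (hF : F.Nonempty) :
    ∃ (k : ℕ) (G : Finset κ), G ⊆ F.image p ∧ (∀ P ∈ G, ∀ P' ∈ G, col P = col P') ∧
      (∀ P ∈ G, 2 ^ k ≤ (F.filter fun i => p i = P).card) ∧
      F.card ≤ (Nat.log 2 F.card + 1) * Fintype.card γ * (G.card * 2 ^ (k + 1)) := by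
  let fib : κ → ℕ := fun P => (F.filter fun i => p i = P).card
  let cls : κ → ℕ × γ := fun P => (Nat.log 2 (fib P), col P)
  let t : Finset (ℕ × γ) := Finset.range (Nat.log 2 F.card + 1) ×ˢ Finset.univ
  have hmaps : ∀ i ∈ F, cls (p i) ∈ t := fun i _ => Finset.mem_product.2
    ⟨Finset.mem_range.2 (Nat.lt_succ_of_le
      (Nat.log_mono_right (b := 2) (Finset.card_le_card (Finset.filter_subset (fun j => p j = p i) F)))), Finset.mem_univ _⟩
  obtain ⟨i₀, hi₀⟩ := hF
  have htne : t.Nonempty := ⟨_, hmaps i₀ hi₀⟩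
  have htc : t.card = (Nat.log 2 F.card + 1) * Fintype.card γ := by
    simp [t]
  obtain ⟨y, -, hy⟩ := Finset.exists_max_image t
    (fun y => (F.filter fun i => cls (p i) = y).card) htne
  have hsum : F.card ≤ t.card * (F.filter fun i => cls (p i) = y).card := by
    rw [Finset.card_eq_sum_card_fiberwise hmaps, ← smul_eq_mul]
    exact Finset.sum_le_card_nsmul _ _ _ hy
  refine ⟨y.1, (F.image p).filter fun P => cls P = y, Finset.filter_subset _ _, ?_, ?_, ?_⟩
  · intro P hP P' hP'
    have h := (Finset.mem_filter.1 hP).2.trans (Finset.mem_filter.1 hP').2.symm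
    exact congrArg Prod.snd h
  · intro P hP
    obtain ⟨hP, hc⟩ := Finset.mem_filter.1 hP
    obtain ⟨i, hi, rfl⟩ := Finset.mem_image.1 hP
    rw [← hc]
    have hmem : i ∈ F.filter fun j => p j = p i := Finset.mem_filter.2 ⟨hi, rfl⟩
    exact Nat.pow_log_le_self 2 (Finset.card_pos.2 ⟨i, hmem⟩).ne'
  · rw [htc] at hsum
    refine hsum.trans (Nat.mul_le_mul_left _ ?_)
    refine Finset.card_le_mul_card_image_of_maps_to (f := p) ?_ _ ?_ |>.trans_eq (mul_comm _ _)
    · intro i hi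
      obtain ⟨hi, hc⟩ := Finset.mem_filter.1 hi
      exact Finset.mem_filter.2 ⟨Finset.mem_image_of_mem _ hi, hc⟩
    · intro P hP
      have hc := (Finset.mem_filter.1 hP).2
      refine (Finset.card_le_card (Finset.filter_subset_filter _ (Finset.filter_subset _ _))).trans
        ?_
      rw [← hc]
      exact (Nat.lt_pow_succ_log_self one_lt_two (fib P)).le

lemma natLog_add_one_le {N : ℕ} {τ B : ℝ} (hτ : 0 < τ) (hB : 1 ≤ B) (hlog : Real.log (1 / τ) ≤ B)
    (hN0 : 0 < N) (hN : (N : ℝ) ≤ 36 * B * (1 / τ) ^ 4) : ((Nat.log 2 N + 1 : ℕ) : ℝ) ≤ 21 * B := by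
  have h1 : Real.log N ≤ 10 * B := by
    have hN0' : (0 : ℝ) < N := by exact_mod_cast hN0
    have hB0 : 0 < B := by linarith
    have := Real.log_le_log hN0' hN
    rw [Real.log_mul (by positivity) (by positivity), Real.log_mul (by norm_num) hB0.ne',
      Real.log_pow] at this
    have e1 : Real.log 36 ≤ 5 := by
      rw [Real.log_le_iff_le_exp (by norm_num)]
      calc (36 : ℝ) ≤ 2.7 ^ 5 := by norm_num
        _ ≤ Real.exp 1 ^ 5 := by gcongr; linarith [Real.exp_one_gt_d9]
        _ = Real.exp 5 := by rw [← Real.exp_nat_mul]; norm_num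
    have e2 := Real.log_le_sub_one_of_pos hB0
    push_cast at this
    linarith
  have h2 := Real.natLog_le_logb N 2
  rw [Real.logb, le_div_iff₀ (Real.log_pos (by norm_num))] at h2
  have h3 := Real.log_two_gt_d9
  push_cast at h2 ⊢
  have h4 : (0 : ℝ) ≤ Nat.log 2 N := by positivity
  nlinarith

lemma XRayEstimate.card_le {Ceq d α β A₀ : ℝ} (hCeq : 1 ≤ Ceq) (hd2 : 2 < d)
    (hα : 0 < α) (hα1 : α < 1) (hA₀ : 0 < A₀) (hX : XRayEstimate Ceq d α β A₀)
    {K : ℕ} (hK : 32 * Ceq ≤ K) {τ m B : ℝ} (hτ : 0 < τ) (hτ1 : τ < 1) (hm : 0 ≤ m) (hB : 1 ≤ B)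
    (G : Finset Tube) (hG : ∀ T ∈ G, OnGrid (τ / 8) T)
    (hcol : ∀ T ∈ G, ∀ T' ∈ G, tubeColor (τ / 8) K T = tubeColor (τ / 8) K T')
    (hmult : DirMultLE τ G m)
    (hvol : volume (⋃ T ∈ G, T.set τ) ≤ ENNReal.ofReal (B * τ ^ (3 - d))) :
    G.card * τ ^ 2 ≤ 324 * A₀ * m ^ (1 - β) * B := by
  classical
  have hK32 : 32 ≤ K := by
    have : (32 : ℝ) ≤ K := by linarith
    exact_mod_cast this
  have hsep : Separated τ (Tube.dir '' (G : Set Tube)) := by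
    rintro _ ⟨T, hT, rfl⟩ _ ⟨T', hT', rfl⟩ hne
    exact Tube.separated_dir hτ hK32 (hG T hT) (hG T' hT') (hcol T hT T' hT') hne
  have hdist : EssDistinct Ceq τ G := by
    refine ⟨G.finite_toSet, fun T hT => ?_⟩
    have : {T' ∈ (G : Set Tube) | T' ≠ T ∧ TubeEquiv Ceq τ T T'} = ∅ := by
      refine eq_empty_of_forall_notMem fun T' hT' => hT'.2.1 ?_
      exact (Tube.eq_of_equiv hτ hCeq hK (hG T hT) (hG T' hT'.1) (hcol T hT T' hT'.1) hT'.2.2).symm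
    rw [this, ncard_empty]
    push_cast; linarith
  have hcard : τ ^ 2 * ((Tube.dir '' (G : Set Tube)).ncard : ℝ) ≤ 324 := by
    rw [← Finset.coe_image, Set.ncard_coe_finset]
    have h1 : ∀ v ∈ G.image Tube.dir, IsDirection v := by
      intro v hv
      obtain ⟨T, -, rfl⟩ := Finset.mem_image.1 hv
      exact T.isDirection_dir
    have h2 := card_le_of_cap (G.image Tube.dir) id h1 (σ := τ / 3) (M := 1) (by positivity)
      (by linarith) zero_le_one (card_filter_le_one_of_separated _ _ hτ fun v hv w hw hvw =>
        hsep v (by simpa using hv) w (by simpa using hw) hvw)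
    have h3 : 36 * (1 / (τ / 3)) ^ 2 * 1 = 324 / τ ^ 2 := by field_simp; norm_num
    rw [h3, le_div_iff₀ (by positivity)] at h2
    linarith
  have hx := hX τ hτ hτ1 (Tube.dir '' (G : Set Tube))
    (by rintro _ ⟨T, -, rfl⟩; exact T.isDirection_dir) hsep (G.finite_toSet.image _) G hdist
    (fun T hT => mem_image_of_mem _ hT) m hmult
  have hmass := card_mul_le_tubeNorm G hτ (d := d) (by linarith)
  have hB0 : 0 < B := by linarith
  have hd0 : 0 < d := by linarith
  have hvol' : volume (⋃ T ∈ G, T.set τ) ^ (1 / d) ≤ ENNReal.ofReal (B * τ ^ (3 / d - 1)) := by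
    refine (ENNReal.rpow_le_rpow hvol (by positivity)).trans ?_
    rw [ENNReal.ofReal_rpow_of_nonneg (by positivity) (by positivity)]
    apply ENNReal.ofReal_le_ofReal
    rw [Real.mul_rpow hB0.le (by positivity), ← Real.rpow_mul hτ.le]
    have e : (3 - d) * (1 / d) = 3 / d - 1 := by field_simp
    rw [e]
    gcongr
    calc B ^ (1 / d) ≤ B ^ (1 : ℝ) :=
          Real.rpow_le_rpow_of_exponent_le hB ((div_le_one hd0).2 (by linarith))
      _ = B := Real.rpow_one B
  have htot := hmass.trans (mul_le_mul' hx hvol')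
  have hmp : 0 ≤ m ^ (1 - β) := Real.rpow_nonneg hm _
  have hEα : (τ ^ 2 * ((Tube.dir '' (G : Set Tube)).ncard : ℝ)) ^ α ≤ 324 :=
    calc _ ≤ (324 : ℝ) ^ α := Real.rpow_le_rpow (by positivity) hcard hα.le
      _ ≤ (324 : ℝ) ^ (1 : ℝ) := Real.rpow_le_rpow_of_exponent_le (by norm_num) hα1.le
      _ = 324 := Real.rpow_one _
  rw [← ENNReal.ofReal_mul (by positivity), ENNReal.ofReal_le_ofReal_iff (by positivity)] at htot
  refine htot.trans ?_
  have e1 : τ ^ (1 - 3 / d) * τ ^ (3 / d - 1) = 1 := by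
    rw [← Real.rpow_add hτ]; simp
  calc _ = A₀ * m ^ (1 - β) * (τ ^ 2 * ((Tube.dir '' (G : Set Tube)).ncard : ℝ)) ^ α * B *
        (τ ^ (1 - 3 / d) * τ ^ (3 / d - 1)) := by ring
    _ ≤ A₀ * m ^ (1 - β) * 324 * B * (τ ^ (1 - 3 / d) * τ ^ (3 / d - 1)) := by gcongr
    _ = _ := by rw [e1]; ring

lemma coe_filter_ncard {ι : Type*} (F : Finset ι) (p : ι → Prop) [DecidablePred p] :
    {i ∈ (F : Set ι) | p i}.ncard = (F.filter p).card := by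
  rw [← Set.ncard_coe_finset]
  congr 1
  ext; simp

lemma le_rpow_of_le_mul_rpow {m Y β : ℝ} (hm : 0 < m) (hβ : 0 < β)
    (h : m ≤ Y * m ^ (1 - β)) : m ≤ Y ^ (1 / β) := by
  have h1 : m ^ β ≤ Y := by
    rw [Real.rpow_sub hm, Real.rpow_one, mul_div_assoc', le_div_iff₀ (by positivity)] at h
    exact le_of_mul_le_mul_left (by linarith) hm
  calc m = (m ^ β) ^ (1 / β) := by
        rw [← Real.rpow_mul hm.le, mul_one_div_cancel hβ.ne', Real.rpow_one]
    _ ≤ _ := Real.rpow_le_rpow (by positivity) h1 (by positivity)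

set_option maxHeartbeats 1000000 in
open Classical in
/-- A family of `τ²`-tubes, many and direction-separated, whose parent `τ`-tubes occupy a small
volume has a direction-separated family of parents with large fibres. -/
lemma XRayEstimate.exists_parents {Ceq d α β A₀ : ℝ} (hCeq : 1 ≤ Ceq) (hd2 : 2 < d)
    (hα : 0 < α) (hα1 : α < 1) (hβ : 0 < β) (hA₀ : 0 < A₀) (hX : XRayEstimate Ceq d α β A₀) :
    ∃ K c : ℝ, 1 ≤ K ∧ 1 ≤ c ∧ ∀ τ B : ℝ, 0 < τ → τ ≤ 1 / 2 → 1 ≤ B → Real.log (1 / τ) ≤ B →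
      ∀ F : Finset Tube, DirMultLE (τ ^ 2) F B → (1 / τ ^ 2) ^ 2 ≤ B * F.card →
      volume (⋃ T ∈ F, (parent τ T).set τ) ≤ ENNReal.ofReal (B * τ ^ (3 - d)) →
      ∃ G : Finset Tube, G ⊆ F.image (parent τ) ∧ DirMultLE τ G (K * B ^ c) ∧
        1 / τ ^ 2 ≤ K * B ^ c * G.card ∧ G.card ≤ K * B ^ c * (1 / τ ^ 2) ∧
        ∀ P ∈ G, 1 / τ ^ 2 ≤ K * B ^ c * (F.filter fun T => parent τ T = P).card ∧
          (F.filter fun T => parent τ T = P).card ≤ K * B ^ c * (1 / τ ^ 2) := by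
  obtain ⟨R, hR⟩ := exists_nat_ge (32 * Ceq)
  have hR0 : 0 < R := by
    have : (0 : ℝ) < R := by linarith
    exact_mod_cast this
  have : NeZero R := ⟨hR0.ne'⟩
  set Q : ℝ := (R : ℝ) ^ 4 with hQ
  have hQ1 : 1 ≤ Q := one_le_pow₀ (by exact_mod_cast hR0)
  set Z : ℝ := 42 * 324 * 144 * Q * A₀ with hZ
  have hZ0 : 0 < Z := by positivity
  set K : ℝ := 36 * Z ^ (1 / β) + 6048 * Q with hK
  refine ⟨K, 4 / β + 3, ?_, ?_, ?_⟩
  · have : 0 ≤ Z ^ (1 / β) := by positivity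
    linarith
  · have : 0 < 4 / β := by positivity
    linarith
  intro τ B hτ hτ2 hB hlog F hF hFcard hvol
  have hB0 : 0 < B := by linarith
  set D : ℝ := K * B ^ (4 / β + 3) with hD
  have hB4 : 1 ≤ B ^ (4 / β) := Real.one_le_rpow hB (by positivity)
  have hB3 : 1 ≤ B ^ (3 : ℝ) := Real.one_le_rpow hB (by positivity)
  have hZβ : 0 < Z ^ (1 / β) := by positivity
  have hD1 : 36 * (Z * B ^ 4) ^ (1 / β) ≤ D := by
    have e : (B ^ 4) ^ (1 / β) = B ^ (4 / β) := by
      rw [← Real.rpow_natCast B 4, ← Real.rpow_mul hB0.le]; congr 1; push_cast; ring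
    rw [Real.mul_rpow hZ0.le (by positivity), e, hD, Real.rpow_add hB0]
    calc 36 * (Z ^ (1 / β) * B ^ (4 / β)) = 36 * Z ^ (1 / β) * (B ^ (4 / β) * 1) := by ring
      _ ≤ K * (B ^ (4 / β) * B ^ (3 : ℝ)) := by
        gcongr
        linarith
  have hD2 : 6048 * Q * B ^ 3 ≤ D := by
    have e : B ^ 3 = B ^ (3 : ℝ) := by norm_cast
    rw [e, hD, Real.rpow_add hB0]
    calc 6048 * Q * B ^ (3 : ℝ) = 6048 * Q * (1 * B ^ (3 : ℝ)) := by ring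
      _ ≤ K * (B ^ (4 / β) * B ^ (3 : ℝ)) := by
        gcongr
        linarith
  have hτ1 : τ ≤ 1 := by linarith
  have hF' : ∀ ω : R3, ((F.filter fun T => dist T.dir ω ≤ τ ^ 2).card : ℝ) ≤ B := by
    intro ω
    have := hF ω
    rwa [coe_filter_ncard] at this
  have hτ2' : 0 < τ ^ 2 := by positivity
  have hcap := card_filter_dist_le F Tube.dir (fun T _ => T.dir_two) hτ2'
    (r := 2 * τ) (by nlinarith) hB0.le hF'
  have hcap' : 36 * (2 * τ / τ ^ 2) ^ 2 * B = 144 * B * (1 / τ ^ 2) := by field_simp; norm_num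
  rw [hcap'] at hcap
  have hFle := card_le_of_cap F Tube.dir (fun T _ => T.isDirection_dir) hτ2'
    (by nlinarith) hB0.le hF'
  have hFne : F.Nonempty := by
    rw [Finset.nonempty_iff_ne_empty]
    rintro rfl
    simp only [Finset.card_empty, Nat.cast_zero, mul_zero] at hFcard
    have : 0 < (1 / τ ^ 2) ^ 2 := by positivity
    linarith
  obtain ⟨k, G, hGF, hGcol, hGfib, hGcard⟩ :=
    exists_uniform_fibers F (parent τ) (tubeColor (τ / 8) R) hFne
  have hL := natLog_add_one_le hτ hB hlog hFne.card_pos (by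
    refine hFle.trans_eq ?_
    field_simp)
  set x : ℝ := 2 ^ k with hx
  have hx0 : 0 < x := by positivity
  set m : ℝ := 144 * B * (1 / τ ^ 2) / x with hm
  have hm0 : 0 < m := by positivity
  have hmx : m * x = 144 * B * (1 / τ ^ 2) := div_mul_cancel₀ _ hx0.ne'
  have hmult : ∀ ω : R3, ((G.filter fun P => dist P.dir ω ≤ τ).card : ℝ) ≤ m := by
    intro ω
    rw [hm, le_div_iff₀ hx0]
    refine le_trans ?_ (hcap ω)
    set S := G.filter fun P => dist P.dir ω ≤ τ
    have h : 2 ^ k * S.card ≤ (F.filter fun T => parent τ T ∈ S).card := by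
      refine Finset.mul_card_image_le_card_of_maps_to (f := parent τ)
        (fun T hT => (Finset.mem_filter.1 hT).2) _ fun P hP => ?_
      refine (hGfib P (Finset.mem_filter.1 hP).1).trans (Finset.card_le_card fun T hT => ?_)
      obtain ⟨hTF, rfl⟩ := Finset.mem_filter.1 hT
      exact Finset.mem_filter.2 ⟨Finset.mem_filter.2 ⟨hTF, hP⟩, rfl⟩
    have h' : S.card * x ≤ ((F.filter fun T => parent τ T ∈ S).card : ℝ) := by
      rw [hx, mul_comm]; exact_mod_cast h
    refine h'.trans ?_
    norm_cast
    refine Finset.card_le_card (Finset.monotone_filter_right _ fun T _ hT => ?_)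
    have h1 := (Finset.mem_filter.1 hT).2
    have h2 := dist_parent_dir hτ T
    have h3 := dist_triangle T.dir (parent τ T).dir ω
    linarith
  have hmult' : DirMultLE τ G m := by
    intro ω
    rw [coe_filter_ncard]
    exact hmult ω
  have hvolG : volume (⋃ T ∈ G, T.set τ) ≤ ENNReal.ofReal (B * τ ^ (3 - d)) := by
    refine (measure_mono (iUnion₂_subset fun P hP => ?_)).trans hvol
    obtain ⟨T, hT, rfl⟩ := Finset.mem_image.1 (hGF hP)
    exact subset_biUnion_of_mem (u := fun T : Tube => (parent τ T).set τ) hT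
  have hgrid : ∀ P ∈ G, OnGrid (τ / 8) P := by
    intro P hP
    obtain ⟨T, hT, rfl⟩ := Finset.mem_image.1 (hGF hP)
    exact onGrid_parent hτ T
  have hxray := hX.card_le hCeq hd2 hα hα1 hA₀ hR hτ (by linarith) hm0.le hB G hgrid hGcol
    hmult' hvolG
  have hfibup : ∀ P ∈ G, ((F.filter fun T => parent τ T = P).card : ℝ) ≤
      144 * B * (1 / τ ^ 2) := by
    intro P _
    refine le_trans ?_ (hcap P.dir)
    norm_cast
    refine Finset.card_le_card (Finset.monotone_filter_right _ fun T _ hTP => ?_)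
    have := dist_parent_dir hτ T
    rw [hTP] at this
    linarith
  have hmain : (1 / τ ^ 2) ^ 2 ≤ 42 * Q * B ^ 2 * G.card * x := by
    have h1 : (F.card : ℝ) ≤ 21 * B * Q * (G.card * (2 * x)) := by
      have h2 : (F.card : ℝ) ≤ ((Nat.log 2 F.card + 1 : ℕ) : ℝ) * Q * (G.card * (2 * x)) := by
        have e : Fintype.card (ZMod R × ZMod R × ZMod R × ZMod R) = R ^ 4 := by
          simp only [Fintype.card_prod, ZMod.card]; ring
        rw [e] at hGcard
        rw [hQ, hx, mul_comm 2, ← pow_succ]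
        exact_mod_cast hGcard
      refine h2.trans ?_
      gcongr
    calc _ ≤ B * F.card := hFcard
      _ ≤ B * (21 * B * Q * (G.card * (2 * x))) := by gcongr
      _ = _ := by ring
  have hGne : G.Nonempty := by
    rw [Finset.nonempty_iff_ne_empty]
    rintro rfl
    simp only [Finset.card_empty, Nat.cast_zero, mul_zero, zero_mul] at hmain
    have : 0 < (1 / τ ^ 2) ^ 2 := by positivity
    linarith
  have hmD : 36 * m ≤ D := by
    refine le_trans ?_ hD1
    gcongr
    refine le_rpow_of_le_mul_rpow hm0 hβ ?_
    set u : ℝ := 1 / τ ^ 2 with hu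
    have hu0 : 0 < u := by positivity
    have huτ : u * τ ^ 2 = 1 := by rw [hu]; field_simp
    have h1 : m * (u * u) ≤ Z * B ^ 4 * m ^ (1 - β) * (u * u) := by
      calc m * (u * u) = u ^ 2 * m := by ring
        _ ≤ 42 * Q * B ^ 2 * G.card * x * m := by gcongr
        _ = 42 * Q * B ^ 2 * (G.card * τ ^ 2) * u * (m * x) := by
          linear_combination (-(42 * Q * B ^ 2 * G.card * x * m)) * huτ
        _ ≤ 42 * Q * B ^ 2 * (324 * A₀ * m ^ (1 - β) * B) * u * (m * x) := by gcongr
        _ = _ := by rw [hmx, hZ]; ring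
    exact le_of_mul_le_mul_right h1 (by positivity)
  have hxle : x ≤ 144 * B * (1 / τ ^ 2) := by
    obtain ⟨P, hP⟩ := hGne
    refine le_trans ?_ (hfibup P hP)
    rw [hx]
    exact_mod_cast hGfib P hP
  have hu0 : 0 < 1 / τ ^ 2 := by positivity
  refine ⟨G, hGF, fun ω => (hmult' ω).trans (by linarith), ?_, ?_, fun P hP => ⟨?_, ?_⟩⟩
  · have h1 : 1 / τ ^ 2 * (1 / τ ^ 2) ≤ D * G.card * (1 / τ ^ 2) := by
      calc _ = (1 / τ ^ 2) ^ 2 := by ring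
        _ ≤ 42 * Q * B ^ 2 * G.card * x := hmain
        _ ≤ 42 * Q * B ^ 2 * G.card * (144 * B * (1 / τ ^ 2)) := by gcongr
        _ = 6048 * Q * B ^ 3 * G.card * (1 / τ ^ 2) := by ring
        _ ≤ _ := by gcongr
    exact le_of_mul_le_mul_right h1 hu0
  · have h1 := card_le_of_cap G Tube.dir (fun T _ => T.isDirection_dir) hτ hτ1 hm0.le hmult
    calc (G.card : ℝ) ≤ 36 * (1 / τ) ^ 2 * m := h1
      _ = 36 * m * (1 / τ ^ 2) := by field_simp
      _ ≤ _ := by gcongr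
  · have h1 : x ≤ ((F.filter fun T => parent τ T = P).card : ℝ) := by
      rw [hx]; exact_mod_cast hGfib P hP
    calc 1 / τ ^ 2 ≤ 144 * B * (1 / τ ^ 2) := by nlinarith
      _ = m * x := hmx.symm
      _ ≤ D * x := by gcongr; linarith
      _ ≤ _ := by gcongr
  · refine (hfibup P hP).trans ?_
    gcongr
    refine le_trans ?_ hD2
    have hB3' : B ≤ B ^ 3 := le_self_pow₀ hB (by norm_num)
    have : B * 1 ≤ B ^ 3 * Q := by gcongr
    linarith

lemma exists_maximal_separated (δ : ℝ) (E : Set R3) :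
    ∃ S ⊆ E, Separated δ S ∧ ∀ y ∈ E, y ∈ S ∨ ∃ x ∈ S, dist y x < δ := by
  obtain ⟨S, hS⟩ := zorn_subset {S : Set R3 | S ⊆ E ∧ Separated δ S} (by
    intro c hc hchain
    refine ⟨⋃₀ c, ⟨sUnion_subset fun s hs => (hc hs).1, ?_⟩, fun s hs => subset_sUnion_of_mem hs⟩
    rintro x ⟨s, hs, hx⟩ y ⟨t, ht, hy⟩ hxy
    rcases hchain.total hs ht with hst | hst
    · exact (hc ht).2 x (hst hx) y hy hxy
    · exact (hc hs).2 x hx y (hst hy) hxy)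
  refine ⟨S, hS.prop.1, hS.prop.2, fun y hy => ?_⟩
  by_contra! h
  refine h.1 (hS.le_of_ge (y := insert y S) ⟨insert_subset hy hS.prop.1, ?_⟩
    (subset_insert _ _) (mem_insert _ _))
  rintro a (rfl | ha) b (rfl | hb) hab
  · exact absurd rfl hab
  · exact h.2 b hb
  · rw [dist_comm]; exact h.2 a ha
  · exact hS.prop.2 a ha b hb hab

lemma exists_cover_of_upperMinkDim_lt {E : Set R3} {D : ℝ}
    (hE : upperMinkDim E < (D : EReal)) :
    ∃ δ₁ : ℝ, 0 < δ₁ ∧ ∀ δ : ℝ, 0 < δ → δ < δ₁ →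
      ∃ S : Finset R3, (S.card : ℝ) ≤ δ ^ (-D) ∧ ∀ y ∈ E, ∃ x ∈ S, dist y x < δ := by
  have hev := Filter.eventually_lt_of_limsup_lt hE
  obtain ⟨δ₂, hδ₂, hsub⟩ := mem_nhdsGT_iff_exists_Ioo_subset.1 hev
  refine ⟨min δ₂ 1, lt_min hδ₂ one_pos, fun δ hδ hδlt => ?_⟩
  have hlt := hsub ⟨hδ, hδlt.trans_le (min_le_left _ _)⟩
  have hlog : 0 < Real.log (1 / δ) :=
    Real.log_pos ((one_lt_div hδ).2 (hδlt.trans_le (min_le_right _ _)))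
  simp only [mem_ofPred_eq] at hlt
  have htop : entropy δ E ≠ ⊤ := by
    intro h
    rw [elog, if_pos h, EReal.top_mul_coe_of_pos (inv_pos.2 hlog)] at hlt
    exact not_top_lt hlt
  rw [elog, if_neg htop, ← EReal.coe_mul, EReal.coe_lt_coe_iff, ← div_eq_mul_inv,
    div_lt_iff₀ hlog] at hlt
  obtain ⟨S, hSE, hSsep, hScov⟩ := exists_maximal_separated δ E
  have hle : ((S.encard : ℕ∞) : ℝ≥0∞) ≤ entropy δ E :=
    le_iSup_of_le S (le_iSup_of_le hSE (le_iSup_of_le hSsep le_rfl))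
  have hfin : S.Finite := by
    rw [← Set.encard_ne_top_iff]
    intro h
    rw [h] at hle
    exact htop (top_le_iff.1 (by simpa using hle))
  refine ⟨hfin.toFinset, ?_, fun y hy => ?_⟩
  · rw [hfin.encard_eq_coe_toFinset_card] at hle
    have h1 : (hfin.toFinset.card : ℝ) ≤ (entropy δ E).toReal := by
      have := ENNReal.toReal_mono htop hle
      simpa using this
    refine h1.trans ?_
    rcases (ENNReal.toReal_nonneg (a := entropy δ E)).eq_or_lt with h0 | h0
    · rw [← h0]; positivity
    · rw [← Real.log_le_log_iff h0 (by positivity), Real.log_rpow hδ]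
      rw [one_div, Real.log_inv] at hlt
      linarith
  · rcases hScov y hy with h | ⟨x, hx, hd⟩
    · exact ⟨y, by simpa using h, by simpa using hδ⟩
    · exact ⟨x, by simpa using hx, hd⟩

/-- The part of a set relevant for tubes: integer vertical translates of the 4-fold dilate. -/
def translates (E : Set R3) (M : ℕ) : Set R3 :=
  {z | ∃ y ∈ E, ∃ n ∈ Finset.Icc (-(M : ℤ)) M, z = (4 : ℝ) • y - (n : ℝ) • vec 0 0 1}

lemma volume_thickening_translates_le {E : Set R3} {D : ℝ} (M : ℕ) {r : ℝ} (hr : 0 < r)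
    (hE : ∃ S : Finset R3, (S.card : ℝ) ≤ r ^ (-D) ∧ ∀ y ∈ E, ∃ x ∈ S, dist y x < r) :
    volume (thickening (2 * r) (translates E M)) ≤
      ENNReal.ofReal (1152 * (2 * M + 1) * r ^ (3 - D)) := by
  obtain ⟨S, hS, hcov⟩ := hE
  have hsub : thickening (2 * r) (translates E M) ⊆
      ⋃ a ∈ Finset.Icc (-(M : ℤ)) M ×ˢ S,
        ball ((4 : ℝ) • a.2 - (a.1 : ℝ) • vec 0 0 1) (6 * r) := by
    intro w hw
    obtain ⟨z, ⟨y, hy, n, hn, rfl⟩, hwz⟩ := mem_thickening_iff.1 hw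
    obtain ⟨x, hx, hyx⟩ := hcov y hy
    refine mem_biUnion (x := (n, x)) (by simpa using ⟨Finset.mem_Icc.1 hn, hx⟩) ?_
    rw [mem_ball]
    have h1 : dist ((4 : ℝ) • y - (n : ℝ) • vec 0 0 1) ((4 : ℝ) • x - (n : ℝ) • vec 0 0 1)
        = 4 * dist y x := by
      rw [dist_sub_right, dist_smul₀]; norm_num
    have h2 := dist_triangle w ((4 : ℝ) • y - (n : ℝ) • vec 0 0 1)
      ((4 : ℝ) • x - (n : ℝ) • vec 0 0 1)
    simp only
    linarith
  refine (measure_mono hsub).trans ((measure_biUnion_finset_le _ _).trans ?_)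
  simp only [EuclideanSpace.volume_ball_fin_three, Finset.sum_const, Finset.card_product]
  have hc : (Finset.Icc (-(M : ℤ)) M).card = 2 * M + 1 := by
    rw [Int.card_Icc]; lia
  rw [hc, ← ENNReal.ofReal_pow (by positivity), ← ENNReal.ofReal_mul (by positivity), nsmul_eq_mul,
    ← ENNReal.ofReal_natCast, ← ENNReal.ofReal_mul (by positivity)]
  apply ENNReal.ofReal_le_ofReal
  have e : r ^ (3 - D) = r ^ (-D) * r ^ 3 := by
    rw [← Real.rpow_natCast, ← Real.rpow_add hr]; congr 1; push_cast; ring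
  have hpi := Real.pi_le_four
  rw [e]
  push_cast
  calc (2 * (M : ℝ) + 1) * S.card * ((6 * r) ^ 3 * (Real.pi * 4 / 3))
      ≤ (2 * (M : ℝ) + 1) * r ^ (-D) * ((6 * r) ^ 3 * (4 * 4 / 3)) := by gcongr
    _ = _ := by ring

lemma norm_vertical_le {v : R3} (hv : IsDirection v) : ‖v‖ ≤ 2 ∧ 1 ≤ ‖v‖ := by
  constructor
  · have h1 := norm_sub_vertical_le hv
    have h2 : ‖vec 0 0 1‖ = 1 := by
      rw [EuclideanSpace.norm_eq, Fin.sum_univ_three]; simp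
    have h3 := norm_le_norm_add_norm_sub' v (vec 0 0 1)
    rw [← dist_eq_norm] at h3
    linarith
  · have := PiLp.norm_apply_le v 2
    rwa [hv.1, norm_one] at this

lemma IsBesicovitch.exists_tubes {E : Set R3} (hE : IsBesicovitch E) {D : ℝ}
    (hdim : upperMinkDim E < (D : EReal)) :
    ∃ (E' : Set R3) (C r₀ : ℝ), 0 < r₀ ∧
      (∀ v, IsDirection v → ∃ T : Tube, T.dir = v ∧ segment ℝ T.p0 T.p1 ⊆ E') ∧
      ∀ r, 0 < r → r < r₀ → volume (thickening (2 * r) E') ≤ ENNReal.ofReal (C * r ^ (3 - D)) := by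
  obtain ⟨r₀, hr₀, hcov⟩ := exists_cover_of_upperMinkDim_lt hdim
  obtain ⟨R, hR⟩ : ∃ R : ℝ, ∀ y ∈ E, |y 2| ≤ R := by
    obtain ⟨S, -, hS⟩ := hcov (r₀ / 2) (by positivity) (by linarith)
    obtain ⟨R, hR⟩ := (S.finite_toSet.isBounded (α := R3)).exists_norm_le
    refine ⟨R + r₀, fun y hy => ?_⟩
    obtain ⟨x, hx, hyx⟩ := hS y hy
    have h1 := hR x hx
    have h2 := PiLp.norm_apply_le y 2
    rw [Real.norm_eq_abs] at h2
    have h3 := norm_le_norm_add_norm_sub' y x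
    rw [← dist_eq_norm] at h3
    linarith
  obtain ⟨M, hM⟩ := exists_nat_ge (4 * R + 1)
  refine ⟨translates E M, 1152 * (2 * M + 1), r₀, hr₀, fun v hv => ?_,
    fun r h0 h1 => volume_thickening_translates_le M h0 (hcov r h0 h1)⟩
  obtain ⟨hv2, hv1⟩ := norm_vertical_le hv
  have hv0 : 0 < ‖v‖ := by linarith
  obtain ⟨x, hx⟩ := hE (‖v‖⁻¹ • v) (by rw [norm_smul, norm_inv, norm_norm, inv_mul_cancel₀ hv0.ne'])
  have hxE : x ∈ E := hx (left_mem_segment ℝ _ _)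
  set n : ℤ := ⌈4 * x 2⌉ with hn
  have hn1 : 4 * x 2 ≤ n := Int.le_ceil _
  have hn2 : (n : ℝ) < 4 * x 2 + 1 := Int.ceil_lt_add_one _
  set t : ℝ := n - 4 * x 2 with ht
  set p : R3 := (4 : ℝ) • x + t • v - (n : ℝ) • vec 0 0 1 with hp
  refine ⟨⟨p, p + v, ?_, ?_, ?_, ?_⟩, ?_, ?_⟩
  · simp [hp, hv.1, ht]
  · simp [hp, hv.1, ht]
  · simpa using hv.2.1
  · simpa using hv.2.2
  · simp [Tube.dir]
  · intro z hz
    rw [segment_eq_image'] at hz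
    obtain ⟨u, ⟨hu0, hu1⟩, rfl⟩ := hz
    have hnM : n ∈ Finset.Icc (-(M : ℤ)) M := by
      have h := abs_le.1 (hR x hxE)
      refine Finset.mem_Icc.2 ⟨?_, ?_⟩
      · have : (-(M : ℝ)) ≤ n := by linarith
        exact_mod_cast this
      · have : (n : ℝ) ≤ M := by linarith
        exact_mod_cast this
    refine ⟨x + ((t + u) * ‖v‖ / 4) • (‖v‖⁻¹ • v), hx ?_, n, hnM, ?_⟩
    · rw [segment_eq_image']
      refine ⟨(t + u) * ‖v‖ / 4, ⟨?_, ?_⟩, ?_⟩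
      · have : 0 ≤ t := by linarith
        positivity
      · have : (t + u) * ‖v‖ ≤ 2 * 2 := by
          apply mul_le_mul <;> linarith
        linarith
      · simp
    · rw [smul_smul, div_mul_eq_mul_div, mul_assoc, mul_inv_cancel₀ hv0.ne']
      change p + u • (p + v - p) = _
      rw [hp]
      module

lemma exists_initial_tubes {E' : Set R3}
    (hE' : ∀ v, IsDirection v → ∃ T : Tube, T.dir = v ∧ segment ℝ T.p0 T.p1 ⊆ E')
    {δ : ℝ} (hδ : 0 < δ) :
    ∃ F : Finset Tube, (∀ T ∈ F, segment ℝ T.p0 T.p1 ⊆ E') ∧ DirMultLE δ F 324 ∧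
      (1 / δ) ^ 2 ≤ 100 * F.card := by
  classical
  have : Nonempty Tube := ⟨(hE' (vec 0 0 1) (by simp [IsDirection])).choose⟩
  choose! f hf using hE'
  set n : ℕ := ⌊1 / (10 * δ)⌋₊ + 1 with hn
  let w : ℕ × ℕ → R3 := fun a => vec (δ * a.1) (δ * a.2) 1
  let I := Finset.range n ×ˢ Finset.range n
  have hw : ∀ a ∈ I, IsDirection (w a) := by
    have key : ∀ i ∈ Finset.range n, |δ * (i : ℝ)| ≤ 1 / 10 := by
      intro i hi
      have h1 : (i : ℝ) ≤ ⌊1 / (10 * δ)⌋₊ := by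
        exact_mod_cast Nat.lt_succ_iff.1 (Finset.mem_range.1 hi)
      have h2 := h1.trans (Nat.floor_le (by positivity))
      rw [le_div_iff₀ (by positivity)] at h2
      rw [abs_of_nonneg (by positivity)]
      linarith
    intro a ha
    obtain ⟨h1, h2⟩ := Finset.mem_product.1 ha
    exact ⟨rfl, key _ h1, key _ h2⟩
  have hsep : ∀ a b, a ≠ b → δ ≤ dist (w a) (w b) := by
    have key : ∀ i j : ℕ, i ≠ j → δ ≤ |δ * i - δ * j| := by
      intro i j hij
      have h3 : (1 : ℝ) ≤ |(i : ℝ) - j| := by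
        have : (1 : ℤ) ≤ |(i : ℤ) - j| := Int.one_le_abs (sub_ne_zero.2 (by exact_mod_cast hij))
        exact_mod_cast this
      rw [← mul_sub, abs_mul, abs_of_pos hδ]
      nlinarith
    intro a b hab
    by_cases h : a.1 = b.1
    · have h' : a.2 ≠ b.2 := fun h' => hab (Prod.ext h h')
      exact (key _ _ h').trans (abs_coord_sub_le_dist (w a) (w b) 1)
    · exact (key _ _ h).trans (abs_coord_sub_le_dist (w a) (w b) 0)
  have hsep' : ∀ a ∈ I, ∀ b ∈ I, f (w a) ≠ f (w b) →
      δ ≤ dist (f (w a)).dir (f (w b)).dir := by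
    intro a ha b hb hab
    rw [(hf _ (hw a ha)).1, (hf _ (hw b hb)).1]
    exact hsep a b fun h => hab (by rw [h])
  refine ⟨I.image fun a => f (w a), ?_, fun ω => ?_, ?_⟩
  · intro T hT
    obtain ⟨a, ha, rfl⟩ := Finset.mem_image.1 hT
    exact (hf _ (hw a ha)).2
  · rw [coe_filter_ncard]
    have h1 := card_filter_le_one_of_separated (I.image fun a => f (w a)) Tube.dir hδ (by
      intro T hT T' hT' hne
      obtain ⟨a, ha, rfl⟩ := Finset.mem_image.1 hT
      obtain ⟨b, hb, rfl⟩ := Finset.mem_image.1 hT'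
      exact hsep' a ha b hb hne)
    refine (card_filter_dist_le _ Tube.dir (fun T _ => T.dir_two) (by positivity) (by linarith)
      zero_le_one h1 ω).trans_eq ?_
    field_simp; norm_num
  · have hinj : Set.InjOn (fun a => f (w a)) I := by
      intro a ha b hb hab
      by_contra hne
      have h1 := hsep a b hne
      rw [← (hf _ (hw a ha)).1, ← (hf _ (hw b hb)).1] at h1
      simp only at hab
      rw [hab, dist_self] at h1
      linarith
    rw [Finset.card_image_of_injOn hinj, Finset.card_product, Finset.card_range]
    have h1 : 1 / (10 * δ) ≤ n := by
      rw [hn]; push_cast; exact (Nat.lt_floor_add_one _).le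
    have h2 : 1 / δ ≤ 10 * n := by
      have e : 1 / δ = 10 * (1 / (10 * δ)) := by field_simp
      rw [e]; gcongr
    calc (1 / δ) ^ 2 ≤ (10 * (n : ℝ)) ^ 2 := by gcongr
      _ = _ := by push_cast; ring

lemma DirMultLE.mono {σ m m' : ℝ} {F F' : Finset Tube} (h : DirMultLE σ F m) (hF : F' ⊆ F)
    (hm : m ≤ m') : DirMultLE σ F' m' := by
  classical
  intro ω
  have := h ω
  rw [coe_filter_ncard] at this ⊢
  refine le_trans ?_ (this.trans hm)
  exact_mod_cast Finset.card_le_card (Finset.filter_subset_filter _ hF)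

open Classical in
lemma stickyWith_parent {τ H C ε : ℝ} {F G : Finset Tube} (hτ : 0 < τ) (hτ2 : τ ≤ 1 / 2)
    (hH : H ≤ (τ ^ 2) ^ (-(C * ε)))
    (hF : DirMultLE (τ ^ 2) F H) (hG : DirMultLE τ G H)
    (hF1 : (1 / τ ^ 2) ^ 2 ≤ H * F.card) (hF2 : F.card ≤ H * (1 / τ ^ 2) ^ 2)
    (hG1 : 1 / τ ^ 2 ≤ H * G.card) (hG2 : G.card ≤ H * (1 / τ ^ 2))
    (hp : ∀ T ∈ F, parent τ T ∈ G)
    (hf : ∀ P ∈ G, 1 / τ ^ 2 ≤ H * (F.filter fun T => parent τ T = P).card ∧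
      (F.filter fun T => parent τ T = P).card ≤ H * (1 / τ ^ 2)) :
    StickyWith 1 C ε (τ ^ 2) F G (parent τ) := by
  have hσ : 0 < τ ^ 2 := by positivity
  have hs : (τ ^ 2) ^ (1 / 2 : ℝ) = τ := by
    rw [← Real.sqrt_eq_rpow, Real.sqrt_sq hτ.le]
  have e1 : (τ ^ 2) ^ (-1 : ℝ) = 1 / τ ^ 2 := by rw [Real.rpow_neg_one, one_div]
  have e2 : (τ ^ 2) ^ (-2 : ℝ) = (1 / τ ^ 2) ^ 2 := by
    rw [Real.rpow_neg hσ.le, one_div, inv_pow]; norm_cast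
  set Y : ℝ := (τ ^ 2) ^ (-(C * ε)) with hY
  have hY0 : 0 < Y := by positivity
  have e3 : (τ ^ 2) ^ (C * ε) = Y⁻¹ := by rw [hY, Real.rpow_neg hσ.le, inv_inv]
  have low : ∀ {u : ℝ} {n : ℕ}, u ≤ H * n → 1⁻¹ * Y⁻¹ * u ≤ n := by
    intro u n h
    rw [inv_one, one_mul, inv_mul_le_iff₀ hY0]
    exact h.trans (by gcongr)
  have up : ∀ {u : ℝ} {n : ℕ}, 0 ≤ u → n ≤ H * u → n ≤ 1 * Y * u := by
    intro u n hu h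
    rw [one_mul]
    exact h.trans (by gcongr)
  have hu : 0 ≤ 1 / τ ^ 2 := by positivity
  unfold StickyWith
  rw [hs, e1, e2, e3, ← hY]
  refine ⟨F.finite_toSet, G.finite_toSet, hF.mono subset_rfl (by linarith),
    hG.mono subset_rfl (by linarith), ?_⟩
  rw [Set.ncard_coe_finset, Set.ncard_coe_finset]
  refine ⟨low hF1, up (by positivity) hF2, low hG1, up hu hG2,
    fun T hT => ⟨hp T hT, set_subset_parent hτ T (by nlinarith)⟩, fun P hP => ?_⟩
  rw [coe_filter_ncard]
  exact ⟨low (hf P hP).1, up hu (hf P hP).2⟩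

/-- Every point of the core of `T` is within `a` of the set `E'`. -/
def CoreNear (a : ℝ) (E' : Set R3) (T : Tube) : Prop :=
  ∀ x ∈ segment ℝ T.p0 T.p1, ∃ y ∈ E', dist x y ≤ a

lemma CoreNear.parent {a τ : ℝ} {E' : Set R3} {T : Tube} (h : CoreNear a E' T) (hτ : 0 < τ) :
    CoreNear (τ / 2 + a) E' (parent τ T) := by
  intro x hx
  obtain ⟨y, hy, hxy⟩ := exists_near_of_parent hτ T hx
  obtain ⟨z, hz, hyz⟩ := h y hy
  exact ⟨z, hz, (dist_triangle x y z).trans (add_le_add hxy hyz)⟩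

lemma volume_biUnion_le_of_coreNear {ι : Type*} {a r : ℝ} {E' : Set R3} {F : Finset ι}
    {p : ι → Tube} (h : ∀ i ∈ F, CoreNear a E' (p i)) (har : a ≤ r) :
    volume (⋃ i ∈ F, (p i).set r) ≤ volume (thickening (2 * r) E') := by
  refine measure_mono (iUnion₂_subset fun i hi x hx => ?_)
  obtain ⟨y, hy, hxy⟩ := mem_thickening_iff.1 hx
  obtain ⟨z, hz, hyz⟩ := h i hi y hy
  exact mem_thickening_iff.2 ⟨z, hz, by linarith [dist_triangle x y z]⟩

lemma mul_card_le_of_fibers {ι κ : Type*} [DecidableEq κ] {F : Finset ι} {G : Finset κ}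
    {p : ι → κ} {u D : ℝ} (hp : ∀ i ∈ F, p i ∈ G)
    (h : ∀ P ∈ G, u ≤ D * (F.filter fun i => p i = P).card) : G.card * u ≤ D * F.card := by
  rw [Finset.card_eq_sum_card_fiberwise hp, Nat.cast_sum, Finset.mul_sum, ← nsmul_eq_mul]
  exact Finset.card_nsmul_le_sum _ _ _ h

lemma filter_parent_filter {ι κ : Type*} [DecidableEq κ] {F : Finset ι} {G : Finset κ}
    {p : ι → κ} {P : κ} (hP : P ∈ G) :
    ((F.filter fun i => p i ∈ G).filter fun i => p i = P) = F.filter fun i => p i = P := by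
  ext i
  simp only [Finset.mem_filter, and_assoc]
  refine and_congr_right fun _ => ⟨fun h => h.2, ?_⟩
  rintro rfl
  exact ⟨hP, rfl⟩

lemma mul_rpow_le_rpow {K B c X : ℝ} {a : ℝ} (hX : 1 ≤ X) (hKX : K ≤ X)
    (hB : 0 ≤ B) (hBX : B ≤ X ^ a) (hc : 0 ≤ c) : K * B ^ c ≤ X ^ (1 + a * c) := by
  have hX0 : 0 < X := by linarith
  rw [Real.rpow_add hX0, Real.rpow_one, Real.rpow_mul hX0.le]
  gcongr

set_option maxHeartbeats 1000000 in
open Classical in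
/-- The doubly sticky collection at a single scale `δ = q⁴`, with constants expressed through one
large parameter `X`. -/
lemma exists_doublySticky {d K c : ℝ} (hK : 1 ≤ K) (hc : 1 ≤ c)
    (hpar : ∀ τ B : ℝ, 0 < τ → τ ≤ 1 / 2 → 1 ≤ B → Real.log (1 / τ) ≤ B →
      ∀ F : Finset Tube, DirMultLE (τ ^ 2) F B → (1 / τ ^ 2) ^ 2 ≤ B * F.card →
      volume (⋃ T ∈ F, (parent τ T).set τ) ≤ ENNReal.ofReal (B * τ ^ (3 - d)) →
      ∃ G : Finset Tube, G ⊆ F.image (parent τ) ∧ DirMultLE τ G (K * B ^ c) ∧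
        1 / τ ^ 2 ≤ K * B ^ c * G.card ∧ G.card ≤ K * B ^ c * (1 / τ ^ 2) ∧
        ∀ P ∈ G, 1 / τ ^ 2 ≤ K * B ^ c * (F.filter fun T => parent τ T = P).card ∧
          (F.filter fun T => parent τ T = P).card ≤ K * B ^ c * (1 / τ ^ 2))
    {E' : Set R3}
    (hE' : ∀ v, IsDirection v → ∃ T : Tube, T.dir = v ∧ segment ℝ T.p0 T.p1 ⊆ E')
    {q X C ε : ℝ} (hq : 0 < q) (hq2 : q ≤ 1 / 2) (hKX : K ≤ X) (hX : 324 ≤ X)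
    (hlog : Real.log (1 / q ^ 2) ≤ X)
    (hvol : ∀ r, q ^ 4 ≤ r → r ≤ q →
      volume (thickening (2 * r) E') ≤ ENNReal.ofReal (X ^ (2 : ℝ) * r ^ (3 - d)))
    (hC : X ^ (4 + 3 * c + 6 * c ^ 2) ≤ (q ^ 2) ^ (-(C * ε))) (hCε : 0 ≤ C * ε) :
    ∃ F G Q : Finset Tube, StickyWith 1 C ε ((q ^ 2) ^ 2) F G (parent (q ^ 2)) ∧
      StickyWith 1 C ε (q ^ 2) G Q (parent q) ∧
      volume (⋃ T ∈ F, T.set (q ^ 4)) ≤ ENNReal.ofReal (X ^ (2 : ℝ) * (q ^ 4) ^ (3 - d)) ∧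
      volume (⋃ T ∈ G, T.set (q ^ 2)) ≤ ENNReal.ofReal (X ^ (2 : ℝ) * (q ^ 2) ^ (3 - d)) ∧
      volume (⋃ T ∈ Q, T.set q) ≤ ENNReal.ofReal (X ^ (2 : ℝ) * q ^ (3 - d)) := by
  have hX1 : 1 ≤ X := by linarith
  have hX0 : 0 < X := by linarith
  set B : ℝ := X ^ (2 : ℝ) with hB
  have hXB : X ≤ B := Real.self_le_rpow_of_one_le hX1 (by norm_num)
  have hB1 : 1 ≤ B := hX1.trans hXB
  have grow : ∀ b : ℝ, 1 ≤ b → b ≤ K * b ^ c := fun b hb =>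
    (Real.self_le_rpow_of_one_le hb hc).trans
      (le_mul_of_one_le_left (by positivity) hK)
  set D₁ : ℝ := K * B ^ c with hD₁
  have hBD₁ : B ≤ D₁ := grow B hB1
  have hD₁1 : 1 ≤ D₁ := hB1.trans hBD₁
  set D₂ : ℝ := K * D₁ ^ c with hD₂
  have hD₁₂ : D₁ ≤ D₂ := grow D₁ hD₁1
  have hD₂1 : 1 ≤ D₂ := hD₁1.trans hD₁₂
  have hD₂3 : D₂ ≤ D₂ ^ 3 := le_self_pow₀ hD₂1 (by norm_num)
  set H : ℝ := 36 * D₂ ^ 3 with hH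
  have hD₂H : 36 * D₂ ≤ H := by rw [hH]; gcongr
  have hHX : H ≤ X ^ (4 + 3 * c + 6 * c ^ 2) := by
    have h1 : D₁ ≤ X ^ (1 + 2 * c) :=
      mul_rpow_le_rpow hX1 hKX (by linarith) le_rfl (by linarith)
    have h2 : D₂ ≤ X ^ (1 + (1 + 2 * c) * c) :=
      mul_rpow_le_rpow hX1 hKX (by linarith) h1 (by linarith)
    calc H ≤ X * (X ^ (1 + (1 + 2 * c) * c)) ^ 3 := by
          rw [hH]; gcongr; linarith
      _ = X ^ (4 + 3 * c + 6 * c ^ 2) := by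
          rw [← Real.rpow_natCast, ← Real.rpow_mul hX0.le, ← Real.rpow_one_add' hX0.le]
          · congr 1; push_cast; ring
          · have : 0 < c := by linarith
            positivity
  have hρ : 0 < q ^ 2 := by positivity
  have hρq : q ^ 2 ≤ q / 2 := by nlinarith
  have hδρ : q ^ 4 ≤ q ^ 2 := by nlinarith
  have hδ0 : 0 < q ^ 4 := by positivity
  have hδsq : (q ^ 2) ^ 2 = q ^ 4 := by ring
  obtain ⟨F₀, hF₀E, hF₀m, hF₀c⟩ := exists_initial_tubes hE' hδ0
  have nearF : ∀ T ∈ F₀, CoreNear 0 E' T := fun T hT x hx =>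
    ⟨x, hF₀E T hT hx, (dist_self x).le⟩
  have hcF₀ : (1 / (q ^ 2) ^ 2) ^ 2 ≤ B * F₀.card := by
    rw [hδsq]
    refine hF₀c.trans ?_
    gcongr
    linarith
  have hF₀m' : DirMultLE ((q ^ 2) ^ 2) F₀ B := by
    rw [hδsq]; exact hF₀m.mono subset_rfl (by linarith)
  obtain ⟨G₀, hG₀F, hG₀m, hG₀1, hG₀2, hG₀f⟩ := hpar (q ^ 2) B hρ (by linarith) hB1
    (hlog.trans hXB) F₀ hF₀m' hcF₀
    ((volume_biUnion_le_of_coreNear (fun T hT => (nearF T hT).parent hρ) (by linarith)).trans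
      (hvol _ hδρ (by linarith)))
  rw [← hD₁] at hG₀m hG₀1 hG₀2 hG₀f
  have nearG : ∀ P ∈ G₀, CoreNear (q ^ 2 / 2 + 0) E' P := by
    intro P hP
    obtain ⟨T, hT, rfl⟩ := Finset.mem_image.1 (hG₀F hP)
    exact (nearF T hT).parent hρ
  have hlogq : Real.log (1 / q) ≤ D₁ := by
    refine le_trans (Real.log_le_log (by positivity) ?_) (hlog.trans (hXB.trans hBD₁))
    apply one_div_le_one_div_of_le hρ; linarith
  have nearGq : ∀ P ∈ G₀, CoreNear (q / 2 + (q ^ 2 / 2 + 0)) E' (parent q P) := fun P hP =>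
    (nearG P hP).parent hq
  have hG₀1' : (1 / q ^ 2) ^ 2 ≤ D₁ * G₀.card := by
    refine le_trans (le_of_eq ?_) hG₀1
    field_simp
  obtain ⟨Q, hQG, hQm, hQ1, hQ2, hQf⟩ := hpar q D₁ hq hq2 hD₁1 hlogq G₀ hG₀m hG₀1'
    ((volume_biUnion_le_of_coreNear nearGq (by linarith)).trans
      ((hvol _ (by linarith) le_rfl).trans
        (ENNReal.ofReal_le_ofReal (by gcongr))))
  rw [← hD₂] at hQm hQ1 hQ2 hQf
  have nearQ : ∀ P ∈ Q, CoreNear (q / 2 + (q ^ 2 / 2 + 0)) E' P := by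
    intro P hP
    obtain ⟨T, hT, rfl⟩ := Finset.mem_image.1 (hQG hP)
    exact nearGq T hT
  set G := G₀.filter fun P => parent q P ∈ Q with hG
  set F := F₀.filter fun T => parent (q ^ 2) T ∈ G with hF
  have hGG₀ : G ⊆ G₀ := Finset.filter_subset _ _
  have hFF₀ : F ⊆ F₀ := Finset.filter_subset _ _
  have hGp : ∀ P ∈ G, parent q P ∈ Q := fun P hP => (Finset.mem_filter.1 hP).2
  have hFp : ∀ T ∈ F, parent (q ^ 2) T ∈ G := fun T hT => (Finset.mem_filter.1 hT).2
  have hGfib : ∀ P ∈ Q, (G.filter fun T => parent q T = P) = G₀.filter fun T => parent q T = P :=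
    fun P hP => filter_parent_filter hP
  have hFfib : ∀ P ∈ G, (F.filter fun T => parent (q ^ 2) T = P) =
      F₀.filter fun T => parent (q ^ 2) T = P := fun P hP => filter_parent_filter hP
  set u : ℝ := 1 / q ^ 2 with hu
  have hu0 : 0 < u := by positivity
  have eu : 1 / (q ^ 2) ^ 2 = u ^ 2 := by rw [hu]; field_simp
  have hGlow : u ^ 2 ≤ D₂ ^ 2 * G.card := by
    have h1 : Q.card * u ≤ D₂ * G.card := mul_card_le_of_fibers hGp fun P hP => by
      rw [hGfib P hP]; exact (hQf P hP).1
    calc u ^ 2 = u * u := by ring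
      _ ≤ (D₂ * Q.card) * u := by gcongr
      _ = D₂ * (Q.card * u) := by ring
      _ ≤ D₂ * (D₂ * G.card) := by gcongr
      _ = _ := by ring
  have hFlow : (u ^ 2) ^ 2 ≤ D₂ ^ 3 * F.card := by
    have h1 : G.card * u ^ 2 ≤ D₁ * F.card := mul_card_le_of_fibers hFp fun P hP => by
      rw [hFfib P hP, ← eu]; exact (hG₀f P (hGG₀ hP)).1
    calc (u ^ 2) ^ 2 = u ^ 2 * u ^ 2 := by ring
      _ ≤ (D₂ ^ 2 * G.card) * u ^ 2 := by gcongr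
      _ = D₂ ^ 2 * (G.card * u ^ 2) := by ring
      _ ≤ D₂ ^ 2 * (D₂ * F.card) :=
          mul_le_mul_of_nonneg_left (h1.trans (by gcongr)) (by positivity)
      _ = _ := by ring
  have hGup : (G.card : ℝ) ≤ D₁ * u ^ 2 := by
    rw [← eu]
    refine le_trans ?_ hG₀2
    exact_mod_cast Finset.card_le_card hGG₀
  have hFup : (F.card : ℝ) ≤ 36 * B * (u ^ 2) ^ 2 := by
    have h1 := card_le_of_cap F₀ Tube.dir (fun T _ => T.isDirection_dir) (σ := (q ^ 2) ^ 2)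
      (by positivity) (by rw [hδsq]; nlinarith) (by linarith : 0 ≤ B) fun ω => by
        have := hF₀m' ω
        rwa [coe_filter_ncard] at this
    rw [eu] at h1
    have h2 : (F.card : ℝ) ≤ F₀.card := by exact_mod_cast Finset.card_le_card hFF₀
    linarith
  have hD₂2 : D₂ ^ 2 ≤ H := by
    have : D₂ ^ 2 ≤ D₂ ^ 3 := pow_le_pow_right₀ hD₂1 (by norm_num)
    linarith
  have hD₁H : D₁ ≤ H := by linarith
  have hD₂H' : D₂ ≤ H := by linarith
  have hBH : B ≤ H := by linarith
  have hCρ : H ≤ (q ^ 2) ^ (-(C * ε)) := hHX.trans hC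
  have hCδ : H ≤ ((q ^ 2) ^ 2) ^ (-(C * ε)) := by
    refine hCρ.trans (Real.rpow_le_rpow_of_nonpos (by positivity) ?_ (by linarith))
    rw [hδsq]; exact hδρ
  refine ⟨F, G, Q, ?_, ?_, ?_, ?_, ?_⟩
  · refine stickyWith_parent hρ (by linarith) hCδ (hF₀m'.mono hFF₀ hBH) (hG₀m.mono hGG₀ hD₁H)
      ?_ ?_ ?_ ?_ hFp fun P hP => ?_
    · rw [eu]; refine hFlow.trans ?_; gcongr; linarith
    · rw [eu]; refine hFup.trans ?_; gcongr; linarith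
    · rw [eu]; refine hGlow.trans ?_; gcongr
    · rw [eu]; refine hGup.trans ?_; gcongr
    · rw [hFfib P hP]
      refine ⟨(hG₀f P (hGG₀ hP)).1.trans ?_, (hG₀f P (hGG₀ hP)).2.trans ?_⟩ <;> gcongr
  · refine stickyWith_parent hq hq2 hCρ (hG₀m.mono hGG₀ hD₁H) (hQm.mono subset_rfl hD₂H')
      ?_ ?_ ?_ ?_ hGp fun P hP => ?_
    · refine hGlow.trans ?_; gcongr
    · refine hGup.trans ?_; gcongr
    · refine hQ1.trans ?_; gcongr
    · refine hQ2.trans ?_; gcongr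
    · rw [hGfib P hP]
      refine ⟨(hQf P hP).1.trans ?_, (hQf P hP).2.trans ?_⟩ <;> gcongr
  · exact (volume_biUnion_le_of_coreNear (p := id) (fun T hT => nearF T (hFF₀ hT))
      hδ0.le).trans (hvol _ le_rfl (by linarith))
  · exact (volume_biUnion_le_of_coreNear (p := id) (fun T hT => nearG T (hGG₀ hT))
      (by linarith)).trans (hvol _ hδρ (by linarith))
  · exact (volume_biUnion_le_of_coreNear (p := id) nearQ (by linarith)).trans
      (hvol _ (by linarith) le_rfl)


/-- The sticky reduction (Proposition 3.3): if an X-ray estimate holds at dimension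
d ∈ (2,3) and there is a Besicovitch set of upper Minkowski dimension < d + ε (ε small),
then for all sufficiently small δ there is a doubly sticky collection 𝕋 of δ-tubes,
with parent collection 𝕋ρ of ρ-tubes (ρ = δ^{1/2}) and grandparent collection 𝕋q of
δ^{1/4}-tubes, obeying the volume bounds |⋃𝕋| ≲ δ^{3-d}, |⋃𝕋ρ| ≲ ρ^{3-d},
|⋃𝕋q| ≲ δ^{(3-d)/4} (up to factors A δ^{-Cε}). -/
theorem sticky_reduction (Ceq d α β A₀ : ℝ) (hCeq : 1 ≤ Ceq) (hd2 : 2 < d) (hd3 : d < 3)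
    (hα : 0 < α) (hα1 : α < 1) (hβ : 0 < β) (hβ1 : β < 1) (hA₀ : 0 < A₀)
    (hX : XRayEstimate Ceq d α β A₀) :
    ∃ A C ε₀ : ℝ, 0 < A ∧ 0 < C ∧ 0 < ε₀ ∧
      ∀ ε : ℝ, 0 < ε → ε < ε₀ →
        (∃ E : Set R3, IsBesicovitch E ∧ upperMinkDim E < ((d + ε : ℝ) : EReal)) →
        ∃ δ₀ : ℝ, 0 < δ₀ ∧ ∀ δ : ℝ, 0 < δ → δ < δ₀ →
          ∃ (𝕋 𝕋ρ 𝕋q : Set Tube) (par₁ par₂ : Tube → Tube),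
            StickyWith A C ε δ 𝕋 𝕋ρ par₁ ∧
            StickyWith A C ε (δ ^ (1/2 : ℝ)) 𝕋ρ 𝕋q par₂ ∧
            volume (⋃ T ∈ 𝕋, T.set δ) ≤
              ENNReal.ofReal (A * δ ^ (-(C * ε)) * δ ^ (3 - d)) ∧
            volume (⋃ T ∈ 𝕋ρ, T.set (δ ^ (1/2 : ℝ))) ≤
              ENNReal.ofReal (A * δ ^ (-(C * ε)) * (δ ^ (1/2 : ℝ)) ^ (3 - d)) ∧
            volume (⋃ T ∈ 𝕋q, T.set (δ ^ (1/4 : ℝ))) ≤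
              ENNReal.ofReal (A * δ ^ (-(C * ε)) * δ ^ ((3 - d) / 4)) := by
  obtain ⟨K, c, hK, hc, hpar⟩ := hX.exists_parents hCeq hd2 hα hα1 hβ hA₀
  have hc0 : 0 < c := by linarith
  set C : ℝ := 2 * (4 + 3 * c + 6 * c ^ 2) with hC
  refine ⟨1, C, 1, one_pos, by positivity, one_pos, fun ε hε _ hE => ?_⟩
  obtain ⟨E, hE, hdim⟩ := hE
  obtain ⟨E', CE, r₀, hr₀, hE', hvol⟩ := hE.exists_tubes hdim
  have hX : Filter.Tendsto (fun δ : ℝ => δ ^ (-ε)) (nhdsWithin 0 (Ioi 0)) Filter.atTop :=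
    tendsto_rpow_neg_nhdsGT_zero (by linarith)
  have hq : Filter.Tendsto (fun δ : ℝ => δ ^ (1 / 4 : ℝ)) (nhdsWithin 0 (Ioi 0)) (nhds 0) := by
    have := (Real.continuousAt_rpow_const 0 (1 / 4 : ℝ) (Or.inr (by norm_num))).tendsto
    rw [Real.zero_rpow (by norm_num)] at this
    exact this.mono_left nhdsWithin_le_nhds
  have hlog : ∀ᶠ δ : ℝ in nhdsWithin 0 (Ioi 0), Real.log (1 / δ) ≤ δ ^ (-ε) := by
    filter_upwards [tendsto_inv_nhdsGT_zero.eventually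
      ((isLittleO_log_rpow_atTop hε).bound one_pos), self_mem_nhdsWithin] with δ h hδ
    have hδ0 : 0 < δ := hδ
    rw [one_mul, Real.norm_of_nonneg (by positivity : (0 : ℝ) ≤ δ⁻¹ ^ ε),
      Real.inv_rpow hδ0.le, ← Real.rpow_neg hδ0.le] at h
    rw [one_div]
    exact (le_abs_self _).trans h
  have hev := ((hX.eventually_ge_atTop (max 324 (max K CE))).and hlog).and
    (hq.eventually_lt_const (lt_min hr₀ (by norm_num : (0 : ℝ) < 1 / 2)))
  obtain ⟨δ₀, hδ₀, hsub⟩ := mem_nhdsGT_iff_exists_Ioo_subset.1 hev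
  refine ⟨δ₀, hδ₀, fun δ hδ hδlt => ?_⟩
  obtain ⟨⟨h1, h2⟩, h3⟩ := hsub ⟨hδ, hδlt⟩
  simp only [max_le_iff, lt_min_iff] at h1 h3
  set q : ℝ := δ ^ (1 / 4 : ℝ) with hqdef
  have hq0 : 0 < q := by positivity
  have eδ : q ^ 4 = δ := by
    rw [hqdef, ← Real.rpow_natCast, ← Real.rpow_mul hδ.le]; norm_num
  have eρ : δ ^ (1 / 2 : ℝ) = q ^ 2 := by
    rw [hqdef, ← Real.rpow_natCast, ← Real.rpow_mul hδ.le]; norm_num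
  have eδ2 : (q ^ 2) ^ 2 = δ := by rw [← eδ]; ring
  set X : ℝ := δ ^ (-ε) with hXdef
  have hX0 : 0 < X := by positivity
  have hδρ : δ ≤ q ^ 2 := by
    rw [← eδ]; exact pow_le_pow_of_le_one hq0.le (by linarith [h3.2]) (by norm_num)
  have hXC : X ^ (4 + 3 * c + 6 * c ^ 2) = (q ^ 2) ^ (-(C * ε)) := by
    rw [hXdef, ← eρ, ← Real.rpow_mul hδ.le, ← Real.rpow_mul hδ.le]
    congr 1; rw [hC]; ring
  have hX2C : X ^ (2 : ℝ) ≤ 1 * δ ^ (-(C * ε)) := by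
    have e : δ ^ (-(C * ε)) = X ^ C := by
      rw [hXdef, ← Real.rpow_mul hδ.le]; congr 1; ring
    rw [one_mul, e]
    refine Real.rpow_le_rpow_of_exponent_le (by linarith) ?_
    rw [hC]; nlinarith [sq_nonneg c]
  have hlogq : Real.log (1 / q ^ 2) ≤ X := by
    refine (Real.log_le_log (by positivity) ?_).trans h2
    exact one_div_le_one_div_of_le hδ hδρ
  have hvolq : ∀ r, q ^ 4 ≤ r → r ≤ q →
      volume (thickening (2 * r) E') ≤ ENNReal.ofReal (X ^ (2 : ℝ) * r ^ (3 - d)) := by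
    intro r hr hrq
    rw [eδ] at hr
    have hr0 : 0 < r := by linarith
    refine (hvol r hr0 (by linarith)).trans (ENNReal.ofReal_le_ofReal ?_)
    have e : r ^ (3 - (d + ε)) = r ^ (-ε) * r ^ (3 - d) := by
      rw [← Real.rpow_add hr0]; congr 1; ring
    have hrX : r ^ (-ε) ≤ X := Real.rpow_le_rpow_of_nonpos hδ hr (by linarith)
    have eX : X ^ (2 : ℝ) = X * X := by rw [Real.rpow_two, sq]
    rw [e, eX, ← mul_assoc]
    gcongr
    exact h1.2.2
  obtain ⟨F, G, Q, hF, hG, hvF, hvG, hvQ⟩ := exists_doublySticky (C := C) (ε := ε)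
    hK hc hpar hE' hq0 h3.2.le h1.2.1 h1.1 hlogq hvolq hXC.le (by positivity)
  rw [eδ2] at hF
  rw [eδ] at hvF
  have e4 : δ ^ ((3 - d) / 4) = q ^ (3 - d) := by
    rw [hqdef, ← Real.rpow_mul hδ.le]; congr 1; ring
  rw [eρ, e4]
  refine ⟨F, G, Q, parent (q ^ 2), parent q, hF, hG, hvF.trans ?_, hvG.trans ?_, hvQ.trans ?_⟩ <;>
    exact ENNReal.ofReal_le_ofReal (by gcongr)

end
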